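/- Let π be a differentiable prior density on ℝ^p satisfying, for a given v > 0, the growth condition ∫_{‖μ‖>1} π(μ)/(‖μ‖² log²(max(‖μ‖, 2))) dμ < ∞ and the asymptotic flatness condition ∫∫ π(μ) ‖ m_{∇π}(z; v)/m_π(z; v) − ∇π(μ)/π(μ) ‖² φ_v(z|μ) dμ dz < ∞. Define j_n(μ) = 1 for ‖μ‖ ≤ 1, j_n(μ) = 1 − log‖μ‖/log n for 1 ≤ ‖μ‖ ≤ n, j_n(μ) = 0 for ‖μ‖ ≥ n (n = 2, 3, …), and π_n = j_n² π. Then Δ_{n,v} := B_Q^v(π_n, μ̂_π) − B_Q^v(π_n, μ̂_{π_n}) → 0 as n → ∞. -/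

import Mathlib

open MeasureTheory Filter
open scoped ENNReal Classical

noncomputable def gauss (p : ℕ) (v : ℝ) (μ z : EuclideanSpace ℝ (Fin p)) : ℝ :=
  (2 * Real.pi * v) ^ (-(p : ℝ) / 2) * Real.exp (-‖z - μ‖ ^ 2 / (2 * v))

/-- Kullback–Leibler loss of the density estimate `g` for the true density `gauss p vy μ`. -/
noncomputable def klLoss (p : ℕ) (vy : ℝ) (μ : EuclideanSpace ℝ (Fin p))
    (g : EuclideanSpace ℝ (Fin p) → ℝ) : ℝ≥0∞ :=
  if (∀ᵐ y, 0 < g y) ∧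
      Integrable (fun y => gauss p vy μ y * Real.log (gauss p vy μ y / g y)) then
    ENNReal.ofReal (∫ y, gauss p vy μ y * Real.log (gauss p vy μ y / g y))
  else ⊤

noncomputable def klRisk (p : ℕ) (vx vy : ℝ) (μ : EuclideanSpace ℝ (Fin p))
    (phat : EuclideanSpace ℝ (Fin p) → EuclideanSpace ℝ (Fin p) → ℝ) : ℝ≥0∞ :=
  ∫⁻ x, klLoss p vy μ (phat x) * ENNReal.ofReal (gauss p vx μ x)

def IsProc (p : ℕ) (phat : EuclideanSpace ℝ (Fin p) → EuclideanSpace ℝ (Fin p) → ℝ) : Prop :=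
  ∀ x, (∀ᵐ y, 0 ≤ phat x y) ∧ (∫ y, phat x y) = 1

def Admissible (p : ℕ) (vx vy : ℝ)
    (phat : EuclideanSpace ℝ (Fin p) → EuclideanSpace ℝ (Fin p) → ℝ) : Prop :=
  IsProc p phat ∧
    ¬ ∃ q, IsProc p q ∧ (∀ μ, klRisk p vx vy μ q ≤ klRisk p vx vy μ phat) ∧
      ∃ μ, klRisk p vx vy μ q < klRisk p vx vy μ phat

noncomputable def marg (p : ℕ) (v : ℝ) (π : EuclideanSpace ℝ (Fin p) → ℝ)
    (z : EuclideanSpace ℝ (Fin p)) : ℝ :=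
  ∫ μ, gauss p v μ z * π μ

noncomputable def bayesRule (p : ℕ) (vx vy : ℝ) (π : EuclideanSpace ℝ (Fin p) → ℝ)
    (x y : EuclideanSpace ℝ (Fin p)) : ℝ :=
  (∫ μ, gauss p vx μ x * gauss p vy μ y * π μ) / marg p vx π x

noncomputable def postMean (p : ℕ) (v : ℝ) (π : EuclideanSpace ℝ (Fin p) → ℝ)
    (z : EuclideanSpace ℝ (Fin p)) : EuclideanSpace ℝ (Fin p) :=
  (marg p v π z)⁻¹ • ∫ μ, (gauss p v μ z * π μ) • μ

noncomputable def qRisk (p : ℕ) (v : ℝ) (μ : EuclideanSpace ℝ (Fin p))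
    (est : EuclideanSpace ℝ (Fin p) → EuclideanSpace ℝ (Fin p)) : ℝ :=
  ∫ z, gauss p v μ z * ‖est z - μ‖ ^ 2

noncomputable def bKL (p : ℕ) (vx vy : ℝ) (ρ : EuclideanSpace ℝ (Fin p) → ℝ)
    (phat : EuclideanSpace ℝ (Fin p) → EuclideanSpace ℝ (Fin p) → ℝ) : ℝ≥0∞ :=
  ∫⁻ μ, klRisk p vx vy μ phat * ENNReal.ofReal (ρ μ)

noncomputable def bQ (p : ℕ) (v : ℝ) (ρ : EuclideanSpace ℝ (Fin p) → ℝ)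
    (est : EuclideanSpace ℝ (Fin p) → EuclideanSpace ℝ (Fin p)) : ℝ :=
  ∫ μ, ρ μ * qRisk p v μ est

noncomputable def margGrad (p : ℕ) (v : ℝ) (π : EuclideanSpace ℝ (Fin p) → ℝ)
    (z : EuclideanSpace ℝ (Fin p)) : EuclideanSpace ℝ (Fin p) :=
  ∫ μ, gauss p v μ z • gradient π μ

/-- The uniform bound `C = (2πv_y)^(-p/2)` on the normal density. -/
noncomputable def Cbound (p : ℕ) (vy : ℝ) : ℝ :=
  (2 * Real.pi * vy) ^ (-(p : ℝ) / 2)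

/-- The Bayes rule associated with a (possibly improper) prior measure `M`. -/
noncomputable def bayesM (p : ℕ) (vx vy : ℝ) (M : Measure (EuclideanSpace ℝ (Fin p)))
    (x y : EuclideanSpace ℝ (Fin p)) : ℝ :=
  (∫ μ, gauss p vx μ x * gauss p vy μ y ∂M) / ∫ μ, gauss p vx μ x ∂M


theorem gauss_pos' (p : ℕ) (v : ℝ) (hv : 0 < v) (μ z : EuclideanSpace ℝ (Fin p)) :
    0 < gauss p v μ z := by
  unfold gauss; positivity

theorem gauss_cont (p : ℕ) (v : ℝ) :
    Continuous (fun q : EuclideanSpace ℝ (Fin p) × EuclideanSpace ℝ (Fin p) =>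
      gauss p v q.1 q.2) := by
  unfold gauss; fun_prop

theorem integrable_exp_neg_sq (p : ℕ) (b : ℝ) (hb : 0 < b) :
    Integrable (fun z : EuclideanSpace ℝ (Fin p) => Real.exp (-b * ‖z‖ ^ 2)) := by
  have h := (GaussianFourier.integrable_cexp_neg_mul_sq_norm_add (V := EuclideanSpace ℝ (Fin p))
    (b := (b : ℂ)) (by simpa using hb) 0 0).norm
  refine h.congr (Eventually.of_forall fun z => ?_)
  simp only [Complex.norm_exp]
  congr 1
  simp [← Complex.ofReal_pow]

theorem gauss_integrable_z (p : ℕ) (v : ℝ) (hv : 0 < v) (μ : EuclideanSpace ℝ (Fin p)) :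
    Integrable (fun z => gauss p v μ z) := by
  have h := (integrable_exp_neg_sq p (1 / (2 * v)) (by positivity)).comp_sub_right μ
  refine (h.const_mul ((2 * Real.pi * v) ^ (-(p : ℝ) / 2))).congr
    (Eventually.of_forall fun z => ?_)
  simp only [gauss]
  congr 2
  ring

theorem gauss_sq_integrable_z (p : ℕ) (v : ℝ) (hv : 0 < v) (μ : EuclideanSpace ℝ (Fin p)) :
    Integrable (fun z => gauss p v μ z * ‖z - μ‖ ^ 2) := by
  have h := (integrable_exp_neg_sq p (1 / (4 * v)) (by positivity)).comp_sub_right μ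
  refine (h.const_mul ((2 * Real.pi * v) ^ (-(p : ℝ) / 2) * (4 * v))).mono' ?_
    (Eventually.of_forall fun z => ?_)
  · apply Continuous.aestronglyMeasurable
    unfold gauss; fun_prop
  · rw [Real.norm_of_nonneg (mul_nonneg (gauss_pos' p v hv μ z).le (by positivity))]
    simp only [gauss]
    have hC : 0 ≤ (2 * Real.pi * v) ^ (-(p : ℝ) / 2) := by positivity
    generalize (2 * Real.pi * v) ^ (-(p : ℝ) / 2) = C at hC
    rw [mul_assoc, mul_assoc]
    apply mul_le_mul_of_nonneg_left _ hC
    set t := ‖z - μ‖ ^ 2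
    have e1 : -t / (2 * v) = -(1 / (4 * v)) * t + -(t / (4 * v)) := by field_simp; ring
    rw [e1, Real.exp_add, mul_assoc, mul_comm (4 * v)]
    apply mul_le_mul_of_nonneg_left _ (Real.exp_pos _).le
    have h2 := Real.add_one_le_exp (t / (4 * v))
    rw [Real.exp_neg, inv_mul_le_iff₀ (Real.exp_pos _)]
    have : t = (t / (4 * v)) * (4 * v) := by field_simp
    nlinarith

/-- total mass of the Gaussian (equal to one, but we do not need that) -/
noncomputable def gmass (p : ℕ) (v : ℝ) : ℝ := ∫ z, gauss p v 0 z
noncomputable def gsec (p : ℕ) (v : ℝ) : ℝ := ∫ z, gauss p v 0 z * ‖z‖ ^ 2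

theorem gauss_mass (p : ℕ) (v : ℝ) (μ : EuclideanSpace ℝ (Fin p)) :
    ∫ z, gauss p v μ z = gmass p v := by
  have := integral_sub_right_eq_self (fun z => gauss p v (0 : EuclideanSpace ℝ (Fin p)) z) μ
    (μ := volume)
  rw [gmass, ← this]
  simp [gauss]

theorem gauss_sec (p : ℕ) (v : ℝ) (μ : EuclideanSpace ℝ (Fin p)) :
    ∫ z, gauss p v μ z * ‖z - μ‖ ^ 2 = gsec p v := by
  have := integral_sub_right_eq_self
    (fun z => gauss p v (0 : EuclideanSpace ℝ (Fin p)) z * ‖z‖ ^ 2) μ (μ := volume)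
  rw [gsec, ← this]
  simp [gauss]

theorem gauss_hasFDerivAt (p : ℕ) (v : ℝ) (hv : 0 < v) (μ z : EuclideanSpace ℝ (Fin p)) :
    HasFDerivAt (fun μ => gauss p v μ z) ((gauss p v μ z / v) • innerSL ℝ (z - μ)) μ := by
  have h1 : HasFDerivAt (fun μ => ‖z - μ‖ ^ 2)
      (2 • (innerSL ℝ (z - μ)).comp (-(ContinuousLinearMap.id ℝ (EuclideanSpace ℝ (Fin p))))) μ := by
    have := ((hasFDerivAt_id μ).const_sub z).norm_sq
    simpa using this
  have h2 := ((h1.neg.mul_const ((2 * v)⁻¹)).exp).const_mul ((2 * Real.pi * v) ^ (-(p : ℝ) / 2))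
  unfold gauss
  simp only [div_eq_mul_inv] at h2 ⊢
  convert! h2 using 1
  ext e
  simp
  field_simp
  ring

/-- Integrability of a product from iterated integrability with a z-kernel of constant mass. -/
theorem kernel_prod_integrable (p : ℕ) (f : EuclideanSpace ℝ (Fin p) → ℝ)
    (k : EuclideanSpace ℝ (Fin p) → EuclideanSpace ℝ (Fin p) → ℝ) (C : ℝ)
    (hk : Continuous (fun q : EuclideanSpace ℝ (Fin p) × EuclideanSpace ℝ (Fin p) => k q.1 q.2))
    (hk0 : ∀ μ z, 0 ≤ k μ z)
    (hki : ∀ μ, Integrable (k μ)) (hkC : ∀ μ, ∫ z, k μ z = C)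
    (hf : Integrable f) :
    Integrable (fun q : EuclideanSpace ℝ (Fin p) × EuclideanSpace ℝ (Fin p) => f q.1 * k q.1 q.2)
      (volume.prod volume) := by
  rw [integrable_prod_iff]
  · refine ⟨Eventually.of_forall fun μ => (hki μ).const_mul (f μ), ?_⟩
    simp only [norm_mul, integral_const_mul]
    refine (hf.norm.mul_const C).congr (Eventually.of_forall fun μ => ?_)
    simp only [← hkC μ]
    congr 2
    ext z
    rw [Real.norm_of_nonneg (hk0 μ z)]
  · exact (hf.aestronglyMeasurable.comp_fst).mul hk.aestronglyMeasurable

theorem tilt_integrable (p : ℕ) (v : ℝ) (hv : 0 < v) (π : EuclideanSpace ℝ (Fin p) → ℝ)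
    (hπ0 : ∀ μ, 0 < π μ) (hπc : Continuous π)
    (hm : ∀ z, Integrable (fun μ => gauss p v μ z * π μ)) (z : EuclideanSpace ℝ (Fin p)) :
    Integrable (fun μ => (gauss p v μ z * π μ) • (μ - z)) := by
  have hcg : Continuous (fun μ => gauss p v μ z) := by
    unfold gauss; fun_prop
  have hco : ∀ i : Fin p, Integrable (fun μ => (gauss p v μ z * π μ) * |(μ - z) i|) := by
    intro i
    have key : ∀ s : ℝ, s ^ 2 = 1 → ∀ μ, gauss p v μ z * Real.exp (s * (μ - z) i) =
        Real.exp (v / 2) * gauss p v μ (z + (v * s) • EuclideanSpace.single i 1) := by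
      intro s hs μ
      simp only [gauss]
      have e : ‖z + (v * s) • EuclideanSpace.single i (1:ℝ) - μ‖ ^ 2
          = ‖z - μ‖ ^ 2 + v ^ 2 - 2 * v * (s * (μ - z) i) := by
        have : z + (v * s) • EuclideanSpace.single i (1:ℝ) - μ
          = (z - μ) + (v * s) • EuclideanSpace.single i (1:ℝ) := by abel
        rw [this, norm_add_sq_real, inner_smul_right, norm_smul]
        rw [EuclideanSpace.inner_single_right]
        simp [mul_pow, hs]
        ring
      rw [e, mul_assoc, ← Real.exp_add, mul_left_comm, ← Real.exp_add]
      congr 2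
      field_simp
      ring
    refine (((hm (z + (v * 1) • EuclideanSpace.single i 1)).add
      (hm (z + (v * (-1)) • EuclideanSpace.single i 1))).const_mul (Real.exp (v / 2))).mono' ?_
      (Eventually.of_forall fun μ => ?_)
    · apply Continuous.aestronglyMeasurable
      fun_prop
    · have hg := gauss_pos' p v hv μ z
      have hp := hπ0 μ
      rw [Real.norm_of_nonneg (by positivity)]
      have h1 := key 1 (by norm_num) μ
      have h2 := key (-1) (by norm_num) μ
      have : Real.exp (v / 2) * (gauss p v μ (z + (v * 1) • EuclideanSpace.single i 1) * π μ +
        gauss p v μ (z + (v * (-1)) • EuclideanSpace.single i 1) * π μ)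
        = (gauss p v μ z * π μ) * (Real.exp (1 * (μ - z) i) + Real.exp (-1 * (μ - z) i)) := by
        linear_combination (-π μ) * h1 - π μ * h2
      simp only [Pi.add_apply]
      rw [this]
      apply mul_le_mul_of_nonneg_left _ (by positivity)
      have a1 := Real.add_one_le_exp (1 * (μ - z) i)
      have a2 := Real.add_one_le_exp (-1 * (μ - z) i)
      have a3 := Real.exp_pos (1 * (μ - z) i)
      have a4 := Real.exp_pos (-1 * (μ - z) i)
      rw [abs_le]; constructor <;> linarith
  refine (integrable_finsetSum Finset.univ (fun i _ => hco i)).mono' ?_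
    (Eventually.of_forall fun μ => ?_)
  · apply Continuous.aestronglyMeasurable
    fun_prop
  · have hg := gauss_pos' p v hv μ z
    have hp := hπ0 μ
    rw [norm_smul, Real.norm_of_nonneg (by positivity), ← Finset.mul_sum]
    apply mul_le_mul_of_nonneg_left _ (by positivity)
    rw [EuclideanSpace.norm_eq]
    apply Real.sqrt_le_iff.2
    refine ⟨Finset.sum_nonneg fun i _ => abs_nonneg _, ?_⟩
    simp only [Real.norm_eq_abs]
    exact Finset.sum_sq_le_sq_sum_of_nonneg (fun i _ => abs_nonneg _)

/-- bias-variance identity -/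
theorem bias_var {α : Type*} [MeasurableSpace α] {m : Measure α} {p : ℕ}
    (w : α → ℝ) (X : α → EuclideanSpace ℝ (Fin p)) (hw : Integrable w m)
    (hX : Integrable (fun x => w x • X x) m) (hX2 : Integrable (fun x => w x * ‖X x‖ ^ 2) m)
    (hM : (∫ x, w x ∂m) ≠ 0) (a : EuclideanSpace ℝ (Fin p)) :
    (∫ x, w x * ‖a - X x‖ ^ 2 ∂m)
      - (∫ x, w x * ‖(∫ x, w x ∂m)⁻¹ • (∫ x, w x • X x ∂m) - X x‖ ^ 2 ∂m)
      = (∫ x, w x ∂m) * ‖a - (∫ x, w x ∂m)⁻¹ • (∫ x, w x • X x ∂m)‖ ^ 2 := by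
  have key : ∀ a : EuclideanSpace ℝ (Fin p), (∫ x, w x * ‖a - X x‖ ^ 2 ∂m) =
      (∫ x, w x ∂m) * ‖a‖ ^ 2 - 2 * inner ℝ a (∫ x, w x • X x ∂m)
        + ∫ x, w x * ‖X x‖ ^ 2 ∂m := by
    intro a
    have e : ∀ x, w x * ‖a - X x‖ ^ 2 = w x * ‖a‖ ^ 2 - 2 * inner ℝ a (w x • X x)
        + w x * ‖X x‖ ^ 2 := by
      intro x
      rw [norm_sub_sq_real, inner_smul_right]; ring
    simp only [e]
    have i1 : Integrable (fun x => w x * ‖a‖ ^ 2 - 2 * inner ℝ a (w x • X x)) m :=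
      (hw.mul_const _).sub ((hX.const_inner a).const_mul 2)
    rw [integral_add i1 hX2, integral_sub (hw.mul_const _) ((hX.const_inner a).const_mul 2), integral_mul_const,
      integral_const_mul, integral_inner hX]
  rw [key, key]
  set M := ∫ x, w x ∂m
  set S := ∫ x, w x • X x ∂m
  rw [norm_sub_sq_real, inner_smul_left, inner_smul_right, norm_smul,
    real_inner_self_eq_norm_sq, mul_pow]
  simp
  field_simp
  ring

theorem jensen_sq {α : Type*} [MeasurableSpace α] {m : Measure α} {p : ℕ}
    (w : α → ℝ) (X : α → EuclideanSpace ℝ (Fin p)) (hw0 : ∀ x, 0 ≤ w x) (hw : Integrable w m)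
    (hX : Integrable (fun x => w x • X x) m) (hX2 : Integrable (fun x => w x * ‖X x‖ ^ 2) m)
    (hM : (∫ x, w x ∂m) ≠ 0) :
    (∫ x, w x ∂m) * ‖(∫ x, w x ∂m)⁻¹ • (∫ x, w x • X x ∂m)‖ ^ 2 ≤ ∫ x, w x * ‖X x‖ ^ 2 ∂m := by
  have h := bias_var w X hw hX hX2 hM 0
  simp only [zero_sub, norm_neg] at h
  have h2 : 0 ≤ (∫ x, w x * ‖(∫ x, w x ∂m)⁻¹ • (∫ x, w x • X x ∂m) - X x‖ ^ 2 ∂m) :=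
    integral_nonneg fun x => mul_nonneg (hw0 x) (by positivity)
  linarith

/-- weighted first moments from weighted second moments -/
theorem first_moment {α : Type*} [MeasurableSpace α] {m : Measure α} {p : ℕ}
    (w : α → ℝ) (X : α → EuclideanSpace ℝ (Fin p)) (hw0 : ∀ x, 0 ≤ w x) (hw : Integrable w m)
    (hXm : AEStronglyMeasurable X m) (hX2 : Integrable (fun x => w x * ‖X x‖ ^ 2) m) :
    Integrable (fun x => w x • X x) m := by
  refine (hw.add hX2).mono' (hw.aestronglyMeasurable.smul hXm) (Eventually.of_forall fun x => ?_)
  rw [norm_smul, Real.norm_of_nonneg (hw0 x)]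
  have := hw0 x
  simp only [Pi.add_apply]
  nlinarith [sq_nonneg (‖X x‖ - 1), norm_nonneg (X x), mul_nonneg this (sq_nonneg (‖X x‖ - 1)),
    mul_nonneg this (sq_nonneg (‖X x‖))]


theorem hasDerivAt_sqpos (t : ℝ) : HasDerivAt (fun t : ℝ => (max t 0) ^ 2) (2 * max t 0) t := by
  rcases lt_trichotomy t 0 with h | h | h
  · rw [max_eq_right h.le, mul_zero]
    refine (hasDerivAt_const t (0 : ℝ)).congr_of_eventuallyEq ?_
    filter_upwards [Iio_mem_nhds h] with x hx
    simp [max_eq_right (le_of_lt (by simpa using hx))]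
  · subst h
    rw [hasDerivAt_iff_isLittleO_nhds_zero]
    simp only [max_self, zero_add, mul_zero, smul_zero, sub_zero]
    norm_num
    have h1 : (fun x : ℝ => (max x 0) ^ 2) =O[nhds 0] (fun x : ℝ => x ^ 2) := by
      refine Asymptotics.IsBigO.of_bound 1 (Eventually.of_forall fun x => ?_)
      rw [one_mul, norm_pow, norm_pow]
      refine pow_le_pow_left₀ (norm_nonneg _) ?_ 2
      rw [Real.norm_eq_abs, Real.norm_eq_abs, abs_of_nonneg (le_max_right _ _)]
      exact max_le (le_abs_self x) (abs_nonneg x)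
    refine h1.trans_isLittleO ?_
    have := Asymptotics.isLittleO_pow_id (𝕜 := ℝ) (n := 2) (by norm_num)
    simpa using this
  · rw [max_eq_left h.le]
    have := hasDerivAt_pow 2 t
    simp only [Nat.cast_ofNat, Nat.add_one_sub_one, pow_one] at this
    refine this.congr_of_eventuallyEq ?_
    filter_upwards [Ioi_mem_nhds h] with x hx
    simp [max_eq_left (le_of_lt (by simpa using hx))]

theorem hasDerivAt_q (s : ℝ) :
    HasDerivAt (fun s : ℝ => (max (Real.log s) 0) ^ 2) (2 * max (Real.log s) 0 * s⁻¹) s := by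
  by_cases hs : s = 0
  · subst hs
    simp only [inv_zero, mul_zero]
    refine (hasDerivAt_const 0 (0 : ℝ)).congr_of_eventuallyEq ?_
    filter_upwards [Ioo_mem_nhds (show (-1 : ℝ) < 0 by norm_num) (show (0:ℝ) < 1 by norm_num)]
      with x hx
    have : Real.log x ≤ 0 := by
      rw [← Real.log_abs]
      exact Real.log_nonpos (abs_nonneg x) (abs_le.2 ⟨hx.1.le, hx.2.le⟩)
    simp [max_eq_right this]
  · exact (hasDerivAt_sqpos (Real.log s)).comp s (Real.hasDerivAt_log hs)

noncomputable def thet (ε s : ℝ) : ℝ := Real.sqrt ((max (Real.log s) 0) ^ 2 + ε ^ 2) - ε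

noncomputable def Hs (ε L s : ℝ) : ℝ := (max (1 - thet ε s / L) 0) ^ 2

noncomputable def Hs' (ε L s : ℝ) : ℝ :=
  2 * max (1 - thet ε s / L) 0 *
    (-((2 * max (Real.log s) 0 * s⁻¹) / (2 * Real.sqrt ((max (Real.log s) 0) ^ 2 + ε ^ 2))) / L)

theorem hasDerivAt_Hs (ε L s : ℝ) (hε : 0 < ε) :
    HasDerivAt (Hs ε L) (Hs' ε L s) s := by
  have h1 := ((hasDerivAt_q s).add_const (ε ^ 2)).sqrt (by positivity)
  have h2 := ((h1.sub_const ε).div_const L).const_sub 1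
  have h3 := (hasDerivAt_sqpos (1 - thet ε s / L)).comp s h2
  unfold Hs'
  rw [neg_div]
  exact h3

theorem thet_nonneg (ε s : ℝ) (hε : 0 < ε) : 0 ≤ thet ε s := by
  unfold thet
  have : ε ≤ Real.sqrt ((max (Real.log s) 0) ^ 2 + ε ^ 2) :=
    Real.le_sqrt_of_sq_le (by nlinarith [sq_nonneg (max (Real.log s) 0)])
  linarith

theorem Hmax_bd (ε L s : ℝ) (hε : 0 < ε) (hL : 0 < L) : 
    0 ≤ max (1 - thet ε s / L) 0 ∧ max (1 - thet ε s / L) 0 ≤ 1 := by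
  refine ⟨le_max_right _ _, max_le ?_ zero_le_one⟩
  have := div_nonneg (thet_nonneg ε s hε) hL.le
  linarith

theorem Hs_bd (ε L s : ℝ) (hε : 0 < ε) (hL : 0 < L) : |Hs ε L s| ≤ 1 := by
  obtain ⟨h1, h2⟩ := Hmax_bd ε L s hε hL
  unfold Hs
  rw [abs_of_nonneg (by positivity)]
  exact pow_le_one₀ h1 h2

theorem Hs'_bd (ε L r : ℝ) (hε : 0 < ε) (hL : 0 < L) (hr : 0 ≤ r) :
    |Hs' ε L (r ^ 2)| * r ≤ 2 / L := by
  obtain ⟨h1, h2⟩ := Hmax_bd ε L (r ^ 2) hε hL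
  unfold Hs'
  by_cases h : r ≤ 1
  · have : Real.log (r ^ 2) ≤ 0 := Real.log_nonpos (by positivity) (pow_le_one₀ hr h)
    rw [max_eq_right this]
    simp
    positivity
  · push Not at h
    set m := max (1 - thet ε (r ^ 2) / L) 0
    set l := max (Real.log (r ^ 2)) 0 with hl
    have hl0 : 0 ≤ l := le_max_right _ _
    set S := Real.sqrt (l ^ 2 + ε ^ 2)
    have hS : l ≤ S := Real.le_sqrt_of_sq_le (by nlinarith)
    have hS0 : 0 < S := Real.sqrt_pos.2 (by positivity)
    have e : 2 * m * (-(2 * l * (r ^ 2)⁻¹ / (2 * S)) / L) = - (2 * m * (l / S) * (r ^ 2)⁻¹ / L) := by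
      field_simp
    rw [e, abs_neg, abs_of_nonneg (by positivity)]
    have hlS : l / S ≤ 1 := (div_le_one hS0).2 hS
    have hlS0 : 0 ≤ l / S := by positivity
    have e2 : 2 * m * (l / S) * (r ^ 2)⁻¹ / L * r = (m * (l / S) * r⁻¹) * (2 / L) := by
      field_simp
    rw [e2]
    have : m * (l / S) * r⁻¹ ≤ 1 := by
      have h3 : r⁻¹ ≤ 1 := inv_le_one_of_one_le₀ h.le
      exact mul_le_one₀ (mul_le_one₀ h2 hlS0 hlS) (by positivity) h3
    have h4 : 0 ≤ 2 / L := by positivity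
    nlinarith

theorem thet_tendsto (s : ℝ) :
    Tendsto (fun ε => thet ε s) (nhds 0) (nhds (max (Real.log s) 0)) := by
  have : Continuous (fun ε => thet ε s) := by unfold thet; fun_prop
  have h := this.tendsto 0
  have e : thet 0 s = max (Real.log s) 0 := by
    unfold thet
    simp [Real.sqrt_sq (le_max_right (Real.log s) 0)]
  rwa [e] at h

theorem Hs_tendsto (L s : ℝ) :
    Tendsto (fun ε => Hs ε L s) (nhds 0) (nhds ((max (1 - max (Real.log s) 0 / L) 0) ^ 2)) := by
  unfold Hs
  exact ((((thet_tendsto s).div_const L).const_sub 1).max tendsto_const_nhds).pow 2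

theorem Hs'_tendsto (L s : ℝ) :
    Tendsto (fun ε => Hs' ε L s) (nhds 0)
      (nhds (if 1 < s then -(2 * max (1 - max (Real.log s) 0 / L) 0 / (s * L)) else
        (if 0 < Real.log s then -(2 * max (1 - max (Real.log s) 0 / L) 0 / (s * L)) else 0))) := by
  by_cases h : 0 < Real.log s
  · have hl : max (Real.log s) 0 ≠ 0 := by rw [max_eq_left h.le]; exact h.ne'
    have hs : s ≠ 0 := by rintro rfl; simp at h
    have hc : Tendsto (fun ε : ℝ => Real.sqrt ((max (Real.log s) 0) ^ 2 + ε ^ 2)) (nhds 0)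
        (nhds (max (Real.log s) 0)) := by
      have : Continuous (fun ε : ℝ => Real.sqrt ((max (Real.log s) 0) ^ 2 + ε ^ 2)) := by fun_prop
      have h := this.tendsto 0
      simpa [Real.sqrt_sq (le_max_right (Real.log s) 0)] using h
    have h1 := ((((thet_tendsto s).div_const L).const_sub 1).max
      (tendsto_const_nhds (x := (0:ℝ)))).const_mul 2
    have h2 := (((tendsto_const_nhds (x := 2 * max (Real.log s) 0 * s⁻¹)).div (hc.const_mul 2)
      (by simpa using hl)).neg).div_const L
    have h3 := h1.mul h2
    unfold Hs'
    convert! h3 using 2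
    simp only [h, if_true, ite_self]
    field_simp
  · have h' := not_lt.1 h
    have : ¬ (1 < s) := fun hs => h (Real.log_pos hs)
    simp only [h, this, if_false]
    unfold Hs'
    simp [max_eq_right h']

noncomputable def jj (p n : ℕ) (μ : EuclideanSpace ℝ (Fin p)) : ℝ :=
  max (1 - max (Real.log ‖μ‖) 0 / Real.log n) 0

noncomputable def Gc (p n : ℕ) (μ : EuclideanSpace ℝ (Fin p)) : ℝ :=
  if 1 < ‖μ‖ then -(2 / (‖μ‖ ^ 2 * Real.log n)) else 0

theorem logn_pos (n : ℕ) (hn : 2 ≤ n) : 0 < Real.log n :=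
  Real.log_pos (by exact_mod_cast (by omega : 1 < n))

theorem jj_eq (p n : ℕ) (hn : 2 ≤ n) (μ : EuclideanSpace ℝ (Fin p)) :
    (if ‖μ‖ ≤ 1 then 1
      else if ‖μ‖ ≤ (n : ℝ) then 1 - Real.log ‖μ‖ / Real.log (n : ℝ)
      else 0) = jj p n μ := by
  have hl := logn_pos n hn
  unfold jj
  split_ifs with h1 h2
  · rw [max_eq_right (Real.log_nonpos (norm_nonneg _) h1)]; simp
  · push Not at h1
    rw [max_eq_left (Real.log_pos h1).le, max_eq_left]
    have := Real.log_le_log (by linarith) h2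
    rw [sub_nonneg, div_le_one hl]; exact this
  · push Not at h1 h2
    rw [max_eq_left (Real.log_pos h1).le, max_eq_right]
    have := Real.log_le_log (by positivity) h2.le
    rw [sub_nonpos, one_le_div hl]; exact this

theorem jj_nonneg (p n : ℕ) (μ : EuclideanSpace ℝ (Fin p)) : 0 ≤ jj p n μ := le_max_right _ _

theorem jj_le_one (p n : ℕ) (μ : EuclideanSpace ℝ (Fin p)) : jj p n μ ≤ 1 := by
  unfold jj
  refine max_le ?_ zero_le_one
  have : 0 ≤ max (Real.log ‖μ‖) 0 / Real.log n := 
    div_nonneg (le_max_right _ _) (Real.log_natCast_nonneg n)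
  linarith

theorem jj_zero (p n : ℕ) (hn : 2 ≤ n) (μ : EuclideanSpace ℝ (Fin p)) (h : (n : ℝ) ≤ ‖μ‖) :
    jj p n μ = 0 := by
  have hl := logn_pos n hn
  have h0 : (2 : ℝ) ≤ n := by exact_mod_cast hn
  unfold jj
  rw [max_eq_left (Real.log_pos (by linarith)).le, max_eq_right]
  have := Real.log_le_log (by positivity) h
  rw [sub_nonpos, one_le_div hl]; exact this

theorem jj_one (p n : ℕ) (μ : EuclideanSpace ℝ (Fin p)) (h : ‖μ‖ ≤ 1) :
    jj p n μ = 1 := by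
  unfold jj
  rw [max_eq_right (Real.log_nonpos (norm_nonneg _) h)]; simp

theorem jj_cont (p n : ℕ) : Continuous (jj p n) := by
  have e : ∀ μ : EuclideanSpace ℝ (Fin p), max (Real.log ‖μ‖) 0 = Real.log (max ‖μ‖ 1) := by
    intro μ
    rcases le_total ‖μ‖ 1 with h | h
    · rw [max_eq_right h, max_eq_right (Real.log_nonpos (norm_nonneg _) h)]; simp
    · rw [max_eq_left h, max_eq_left (Real.log_nonneg h)]
  unfold jj
  simp only [e]
  have : Continuous (fun μ : EuclideanSpace ℝ (Fin p) => Real.log (max ‖μ‖ 1)) := by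
    apply Continuous.log (by fun_prop)
    intro μ
    have := le_max_right ‖μ‖ 1
    positivity
  fun_prop

theorem jj_tendsto (p : ℕ) (μ : EuclideanSpace ℝ (Fin p)) :
    Tendsto (fun n => jj p n μ) atTop (nhds 1) := by
  unfold jj
  have h : Tendsto (fun n : ℕ => Real.log n) atTop atTop :=
    Real.tendsto_log_atTop.comp tendsto_natCast_atTop_atTop
  have := (((tendsto_const_nhds (x := max (Real.log ‖μ‖) 0)).div_atTop h).const_sub 1).max
    (tendsto_const_nhds (x := (0:ℝ)))
  simpa using this

theorem ibp_j (p n : ℕ) (hn : 2 ≤ n) (F : EuclideanSpace ℝ (Fin p) → ℝ) (hF : Differentiable ℝ F)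
    (hFi : Integrable F) (e : EuclideanSpace ℝ (Fin p))
    (hF' : Integrable (fun μ => fderiv ℝ F μ e)) :
    ∫ μ, jj p n μ ^ 2 * fderiv ℝ F μ e
      = - ∫ μ, (jj p n μ * Gc p n μ * inner ℝ μ e) * F μ := by
  have hl := logn_pos n hn
  set L := 2 * Real.log n with hL
  have hL0 : 0 < L := by positivity
  let ε : ℕ → ℝ := fun k => 1 / ((k : ℝ) + 1)
  have hε : ∀ k, 0 < ε k := fun k => by positivity
  have hεt : Tendsto ε atTop (nhds 0) := tendsto_one_div_add_atTop_nhds_zero_nat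
  have hd : ∀ k μ, HasFDerivAt (fun μ : EuclideanSpace ℝ (Fin p) => Hs (ε k) L (‖μ‖ ^ 2))
      (Hs' (ε k) L (‖μ‖ ^ 2) • (2 • innerSL ℝ μ)) μ := by
    intro k μ
    have h2 := (hasDerivAt_Hs (ε k) L (‖μ‖ ^ 2) (hε k)).comp_hasFDerivAt μ
      (hasStrictFDerivAt_norm_sq μ).hasFDerivAt
    exact h2
  have hfd : ∀ k μ, fderiv ℝ (fun μ : EuclideanSpace ℝ (Fin p) => Hs (ε k) L (‖μ‖ ^ 2)) μ e =
      Hs' (ε k) L (‖μ‖ ^ 2) * (2 * inner ℝ μ e) := by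
    intro k μ
    rw [(hd k μ).fderiv]
    simp
  have hc : ∀ k, Continuous (fun μ : EuclideanSpace ℝ (Fin p) => Hs (ε k) L (‖μ‖ ^ 2)) := fun k =>
    continuous_iff_continuousAt.2 fun μ => (hd k μ).continuousAt
  have hb1 : ∀ k (μ : EuclideanSpace ℝ (Fin p)), ‖Hs (ε k) L (‖μ‖ ^ 2)‖ ≤ 1 := fun k μ =>
    Hs_bd _ _ _ (hε k) hL0
  have hb2 : ∀ k (μ : EuclideanSpace ℝ (Fin p)), 
      ‖Hs' (ε k) L (‖μ‖ ^ 2) * (2 * inner ℝ μ e)‖ ≤ 2 / L * (2 * ‖e‖) := by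
    intro k μ
    have h := Hs'_bd (ε k) L ‖μ‖ (hε k) hL0 (norm_nonneg _)
    rw [norm_mul, norm_mul, Real.norm_eq_abs]
    have h2 := norm_inner_le_norm (𝕜 := ℝ) μ e
    calc _ ≤ |Hs' (ε k) L (‖μ‖ ^ 2)| * (2 * (‖μ‖ * ‖e‖)) := by
          norm_num
          gcongr
          exact h2
      _ = (|Hs' (ε k) L (‖μ‖ ^ 2)| * ‖μ‖) * (2 * ‖e‖) := by ring
      _ ≤ _ := by gcongr
  have hm2 : ∀ k, AEStronglyMeasurable (fun μ => Hs' (ε k) L (‖μ‖ ^ 2) * (2 * inner ℝ μ e))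
      (volume : Measure (EuclideanSpace ℝ (Fin p))) := by
    intro k
    have := (measurable_fderiv_apply_const ℝ 
      (fun μ : EuclideanSpace ℝ (Fin p) => Hs (ε k) L (‖μ‖ ^ 2)) e).aestronglyMeasurable
        (μ := volume)
    refine this.congr (Eventually.of_forall fun μ => hfd k μ)
  have hI : ∀ k, ∫ μ, Hs (ε k) L (‖μ‖ ^ 2) * fderiv ℝ F μ e =
      - ∫ μ, (Hs' (ε k) L (‖μ‖ ^ 2) * (2 * inner ℝ μ e)) * F μ := by
    intro k
    have := integral_mul_fderiv_eq_neg_fderiv_mul_of_integrable (μ := volume)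
      (f := fun μ : EuclideanSpace ℝ (Fin p) => Hs (ε k) L (‖μ‖ ^ 2)) (g := F) (v := e) ?_ ?_ ?_
      (fun x _ => (hd k x).differentiableAt) (fun x _ => hF x)
    · simp only [hfd] at this
      exact this
    · simp only [hfd]
      exact hFi.bdd_mul (hm2 k) (Eventually.of_forall (hb2 k))
    · exact hF'.bdd_mul (hc k).aestronglyMeasurable (Eventually.of_forall (hb1 k))
    · exact hFi.bdd_mul (hc k).aestronglyMeasurable (Eventually.of_forall (hb1 k))
  have hlog : ∀ μ : EuclideanSpace ℝ (Fin p), max (Real.log (‖μ‖ ^ 2)) 0 / L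
      = max (Real.log ‖μ‖) 0 / Real.log n := by
    intro μ
    rw [Real.log_pow, hL]
    have : max (((2 : ℕ) : ℝ) * Real.log ‖μ‖) 0 = 2 * max (Real.log ‖μ‖) 0 := by
      rw [mul_max_of_nonneg _ _ (by norm_num : (0:ℝ) ≤ 2)]; simp
    rw [this, mul_div_mul_left _ _ (by norm_num)]
  have t1 : Tendsto (fun k => ∫ μ, Hs (ε k) L (‖μ‖ ^ 2) * fderiv ℝ F μ e) atTop
      (nhds (∫ μ, jj p n μ ^ 2 * fderiv ℝ F μ e)) := by
    refine tendsto_integral_of_dominated_convergence (fun μ => ‖fderiv ℝ F μ e‖)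
      (fun k => (hc k).aestronglyMeasurable.mul hF'.aestronglyMeasurable) hF'.norm
      (fun k => Eventually.of_forall fun μ => ?_) (Eventually.of_forall fun μ => ?_)
    · rw [norm_mul]
      exact mul_le_of_le_one_left (norm_nonneg _) (hb1 k μ)
    · have := (Hs_tendsto L (‖μ‖ ^ 2)).comp hεt
      rw [hlog] at this
      exact this.mul_const _
  have t2 : Tendsto (fun k => ∫ μ, (Hs' (ε k) L (‖μ‖ ^ 2) * (2 * inner ℝ μ e)) * F μ) atTop
      (nhds (∫ μ, (jj p n μ * Gc p n μ * inner ℝ μ e) * F μ)) := by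
    refine tendsto_integral_of_dominated_convergence (fun μ => 2 / L * (2 * ‖e‖) * ‖F μ‖)
      (fun k => (hm2 k).mul hFi.aestronglyMeasurable) (hFi.norm.const_mul _)
      (fun k => Eventually.of_forall fun μ => ?_) (Eventually.of_forall fun μ => ?_)
    · rw [norm_mul]
      exact mul_le_mul_of_nonneg_right (hb2 k μ) (norm_nonneg _)
    · have := ((Hs'_tendsto L (‖μ‖ ^ 2)).comp hεt).mul_const (2 * inner ℝ μ e)
      rw [hlog] at this
      refine Tendsto.mul_const _ ?_
      convert! this using 2
      unfold Gc
      change jj p n μ * _ * _ = _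
      by_cases h : 1 < ‖μ‖
      · have h' : 1 < ‖μ‖ ^ 2 := one_lt_pow₀ h (by norm_num)
        simp only [h, h', if_true]
        change _ = -(2 * jj p n μ / _) * _
        rw [hL]
        field_simp
      · have h' : ‖μ‖ ^ 2 ≤ 1 := pow_le_one₀ (norm_nonneg _) (not_lt.1 h)
        have h'' := Real.log_nonpos (by positivity) h'
        simp only [h, not_lt.2 h', not_lt.2 h'', if_false]
        simp
  have t1' := t1
  simp only [hI] at t1'
  exact tendsto_nhds_unique t1' t2.neg


noncomputable def scr (p : ℕ) (π : EuclideanSpace ℝ (Fin p) → ℝ) (μ : EuclideanSpace ℝ (Fin p)) :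
    EuclideanSpace ℝ (Fin p) := (π μ)⁻¹ • gradient π μ

noncomputable def cc (p : ℕ) (v : ℝ) (π : EuclideanSpace ℝ (Fin p) → ℝ)
    (z : EuclideanSpace ℝ (Fin p)) : EuclideanSpace ℝ (Fin p) :=
  (marg p v π z)⁻¹ • margGrad p v π z

noncomputable def Phi (p : ℕ) (v : ℝ) (π : EuclideanSpace ℝ (Fin p) → ℝ)
    (z μ : EuclideanSpace ℝ (Fin p)) : ℝ :=
  π μ * ‖cc p v π z - scr p π μ‖ ^ 2 * gauss p v μ z

theorem gradient_meas (p : ℕ) (π : EuclideanSpace ℝ (Fin p) → ℝ) : Measurable (gradient π) := by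
  unfold gradient
  exact (LinearIsometryEquiv.continuous _).measurable.comp (measurable_fderiv ℝ π)

theorem scr_meas (p : ℕ) (π : EuclideanSpace ℝ (Fin p) → ℝ) (hπ : Continuous π) :
    Measurable (scr p π) := by
  unfold scr
  exact hπ.measurable.inv.smul (gradient_meas p π)

theorem gauss_cont1 (p : ℕ) (v : ℝ) (z : EuclideanSpace ℝ (Fin p)) :
    Continuous (fun μ => gauss p v μ z) := by
  unfold gauss; fun_prop

theorem gauss_contswap (p : ℕ) (v : ℝ) :
    Continuous (fun q : EuclideanSpace ℝ (Fin p) × EuclideanSpace ℝ (Fin p) =>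
      gauss p v q.2 q.1) := by
  unfold gauss; fun_prop

theorem marg_meas (p : ℕ) (v : ℝ) (π : EuclideanSpace ℝ (Fin p) → ℝ) (hπ : Measurable π) :
    StronglyMeasurable (marg p v π) := by
  unfold marg
  have : StronglyMeasurable (fun q : EuclideanSpace ℝ (Fin p) × EuclideanSpace ℝ (Fin p) =>
      gauss p v q.2 q.1 * π q.2) :=
    ((gauss_contswap p v).measurable.mul (hπ.comp measurable_snd)).stronglyMeasurable
  exact this.integral_prod_right' (ν := volume)

theorem vec_meas (p : ℕ) (v : ℝ) (X : EuclideanSpace ℝ (Fin p) → EuclideanSpace ℝ (Fin p))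
    (hX : Measurable X) :
    StronglyMeasurable (fun z => ∫ μ, gauss p v μ z • X μ) := by
  have : StronglyMeasurable (fun q : EuclideanSpace ℝ (Fin p) × EuclideanSpace ℝ (Fin p) =>
      gauss p v q.2 q.1 • X q.2) :=
    ((gauss_contswap p v).measurable.smul (hX.comp measurable_snd)).stronglyMeasurable
  exact this.integral_prod_right' (ν := volume)

theorem cc_meas (p : ℕ) (v : ℝ) (π : EuclideanSpace ℝ (Fin p) → ℝ) (hπ : Measurable π) :
    StronglyMeasurable (cc p v π) := by
  unfold cc
  exact (marg_meas p v π hπ).inv₀.smul (vec_meas p v _ (gradient_meas p π))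

theorem postMean_meas (p : ℕ) (v : ℝ) (π : EuclideanSpace ℝ (Fin p) → ℝ) (hπ : Measurable π) :
    StronglyMeasurable (postMean p v π) := by
  unfold postMean
  have := vec_meas p v (fun μ => π μ • μ) (hπ.smul measurable_id)
  simp only [smul_smul] at this
  exact (marg_meas p v π hπ).inv₀.smul this

section good

variable (p : ℕ) (v : ℝ) (hv : 0 < v) (π : EuclideanSpace ℝ (Fin p) → ℝ)
    (hπpos : ∀ μ, 0 < π μ) (hπdiff : Differentiable ℝ π)
    (hm : ∀ z, Integrable (fun μ => gauss p v μ z * π μ))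
    (z : EuclideanSpace ℝ (Fin p)) (hz : Integrable (fun μ => Phi p v π z μ))

/-- mass of the truncated measure -/
noncomputable def Mn (p : ℕ) (v : ℝ) (π : EuclideanSpace ℝ (Fin p) → ℝ) (n : ℕ)
    (z : EuclideanSpace ℝ (Fin p)) : ℝ := ∫ μ, jj p n μ ^ 2 * (gauss p v μ z * π μ)

noncomputable def An (p : ℕ) (v : ℝ) (π : EuclideanSpace ℝ (Fin p) → ℝ) (n : ℕ)
    (z : EuclideanSpace ℝ (Fin p)) : EuclideanSpace ℝ (Fin p) :=
  ∫ μ, (jj p n μ ^ 2 * (gauss p v μ z * π μ)) • (scr p π μ - cc p v π z)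

noncomputable def Xn (p n : ℕ) (μ : EuclideanSpace ℝ (Fin p)) : EuclideanSpace ℝ (Fin p) :=
  (Gc p n μ / jj p n μ) • μ

noncomputable def Gn (p n : ℕ) (μ : EuclideanSpace ℝ (Fin p)) : ℝ :=
  jj p n μ ^ 2 * ‖Xn p n μ‖ ^ 2

theorem marg_pos (p : ℕ) (v : ℝ) (hv : 0 < v) (π : EuclideanSpace ℝ (Fin p) → ℝ)
    (hπpos : ∀ μ, 0 < π μ) (hm : ∀ z, Integrable (fun μ => gauss p v μ z * π μ))
    (z : EuclideanSpace ℝ (Fin p)) : 0 < marg p v π z := by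
  unfold marg
  rw [integral_pos_iff_support_of_nonneg
    (fun μ => (mul_pos (gauss_pos' p v hv μ z) (hπpos μ)).le) (hm z)]
  have : Function.support (fun μ => gauss p v μ z * π μ) = Set.univ := by
    ext μ; simp [(mul_pos (gauss_pos' p v hv μ z) (hπpos μ)).ne', (gauss_pos' p v hv μ z).ne',
      (hπpos μ).ne']
  rw [this]
  exact isOpen_univ.measure_pos _ ⟨0, trivial⟩

theorem w_int (p : ℕ) (v : ℝ) (π : EuclideanSpace ℝ (Fin p) → ℝ)
    (hm : ∀ z, Integrable (fun μ => gauss p v μ z * π μ)) (z : EuclideanSpace ℝ (Fin p)) (n : ℕ) : Integrable (fun μ => jj p n μ ^ 2 * (gauss p v μ z * π μ)) := by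
  refine (hm z).bdd_mul (c := 1) ((jj_cont p n).pow 2).aestronglyMeasurable
    (Eventually.of_forall fun μ => ?_)
  rw [Real.norm_of_nonneg (by positivity)]
  exact pow_le_one₀ (jj_nonneg p n μ) (jj_le_one p n μ)

theorem Mn_pos (p : ℕ) (v : ℝ) (hv : 0 < v) (π : EuclideanSpace ℝ (Fin p) → ℝ)
    (hπpos : ∀ μ, 0 < π μ) (hm : ∀ z, Integrable (fun μ => gauss p v μ z * π μ))
    (z : EuclideanSpace ℝ (Fin p)) (n : ℕ) : 0 < Mn p v π n z := by
  have hF : ∀ μ, 0 < gauss p v μ z * π μ := fun μ => mul_pos (gauss_pos' p v hv μ z) (hπpos μ)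
  unfold Mn
  rw [integral_pos_iff_support_of_nonneg
    (fun μ => mul_nonneg (by positivity) (hF μ).le) (w_int p v π hm z n)]
  refine lt_of_lt_of_le (Metric.measure_ball_pos volume (0 : EuclideanSpace ℝ (Fin p))
    zero_lt_one) (measure_mono fun μ hμ => ?_)
  have h1 : ‖μ‖ ≤ 1 := by simpa using (Metric.mem_ball.1 hμ).le
  rw [Function.mem_support, jj_one p n μ h1]
  simpa using ⟨(gauss_pos' p v hv μ z).ne', (hπpos μ).ne'⟩

theorem A1 (p : ℕ) (v : ℝ) (hv : 0 < v) (π : EuclideanSpace ℝ (Fin p) → ℝ)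
    (hπpos : ∀ μ, 0 < π μ) (hπdiff : Differentiable ℝ π)
    (hm : ∀ z, Integrable (fun μ => gauss p v μ z * π μ)) (z : EuclideanSpace ℝ (Fin p))
    (hz : Integrable (fun μ => Phi p v π z μ)) : Integrable (fun μ => (gauss p v μ z * π μ) • (scr p π μ - cc p v π z)) := by
  refine first_moment _ _ (fun μ => (mul_pos (gauss_pos' p v hv μ z) (hπpos μ)).le) (hm z)
    ((scr_meas p π hπdiff.continuous).sub_const _).aestronglyMeasurable ?_
  refine hz.congr (Eventually.of_forall fun μ => ?_)
  simp only [Phi]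
  rw [norm_sub_rev]; ring

theorem A2 (p : ℕ) (v : ℝ) (hv : 0 < v) (π : EuclideanSpace ℝ (Fin p) → ℝ)
    (hπpos : ∀ μ, 0 < π μ) (hπdiff : Differentiable ℝ π)
    (hm : ∀ z, Integrable (fun μ => gauss p v μ z * π μ)) (z : EuclideanSpace ℝ (Fin p))
    (hz : Integrable (fun μ => Phi p v π z μ)) : Integrable (fun μ => gauss p v μ z • gradient π μ) := by
  refine ((A1 p v hv π hπpos hπdiff hm z hz).add ((hm z).smul_const (cc p v π z))).congr
    (Eventually.of_forall fun μ => ?_)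
  have := (hπpos μ).ne'
  simp only [Pi.add_apply, scr, ← smul_add, sub_add_cancel, smul_smul]
  congr 1
  field_simp

theorem A3 (p : ℕ) (v : ℝ) (hv : 0 < v) (π : EuclideanSpace ℝ (Fin p) → ℝ)
    (hπpos : ∀ μ, 0 < π μ) (hπdiff : Differentiable ℝ π)
    (hm : ∀ z, Integrable (fun μ => gauss p v μ z * π μ)) (z : EuclideanSpace ℝ (Fin p))
    (hz : Integrable (fun μ => Phi p v π z μ)) : ∫ μ, (gauss p v μ z * π μ) • (scr p π μ - cc p v π z) = 0 := by
  have e : ∀ μ, (gauss p v μ z * π μ) • (scr p π μ - cc p v π z)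
      = gauss p v μ z • gradient π μ - (gauss p v μ z * π μ) • cc p v π z := by
    intro μ
    have := (hπpos μ).ne'
    simp only [scr, smul_sub, smul_smul]
    congr 2
    field_simp
  simp only [e]
  rw [integral_sub (A2 p v hv π hπpos hπdiff hm z hz) ((hm z).smul_const _), integral_smul_const]
  change margGrad p v π z - marg p v π z • cc p v π z = 0
  unfold cc
  rw [smul_smul, mul_inv_cancel₀ (marg_pos p v hv π hπpos hm z).ne', one_smul, sub_self]

theorem A4 (p : ℕ) (v : ℝ) (hv : 0 < v) (π : EuclideanSpace ℝ (Fin p) → ℝ)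
    (hπpos : ∀ μ, 0 < π μ) (hπdiff : Differentiable ℝ π) (z : EuclideanSpace ℝ (Fin p)) (μ e : EuclideanSpace ℝ (Fin p)) :
    HasFDerivAt (fun μ => gauss p v μ z * π μ) (fderiv ℝ (fun μ => gauss p v μ z * π μ) μ) μ ∧
    fderiv ℝ (fun μ => gauss p v μ z * π μ) μ e
      = inner ℝ (gauss p v μ z • gradient π μ) e
        - v⁻¹ * inner ℝ ((gauss p v μ z * π μ) • (μ - z)) e := by
  have h := (gauss_hasFDerivAt p v hv μ z).mul (hπdiff μ).hasFDerivAt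
  have h' : fderiv ℝ (fun μ => gauss p v μ z * π μ) μ = _ := h.fderiv
  refine ⟨?_, ?_⟩
  · rw [h']; exact h
  rw [h']
  have hg : fderiv ℝ π μ e = inner ℝ (gradient π μ) e := by
    rw [gradient, InnerProductSpace.toDual_symm_apply]
  simp only [ContinuousLinearMap.add_apply, ContinuousLinearMap.smul_apply, hg, inner_smul_left,
    innerSL_apply_apply, smul_eq_mul, inner_sub_left]
  simp
  field_simp
  ring

theorem A5 (p : ℕ) (v : ℝ) (hv : 0 < v) (π : EuclideanSpace ℝ (Fin p) → ℝ)
    (hπpos : ∀ μ, 0 < π μ) (hπdiff : Differentiable ℝ π)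
    (hm : ∀ z, Integrable (fun μ => gauss p v μ z * π μ)) (z : EuclideanSpace ℝ (Fin p))
    (hz : Integrable (fun μ => Phi p v π z μ)) (e : EuclideanSpace ℝ (Fin p)) :
    Integrable (fun μ => fderiv ℝ (fun μ => gauss p v μ z * π μ) μ e) := by
  simp only [(A4 p v hv π hπpos hπdiff z _ e).2]
  exact ((A2 p v hv π hπpos hπdiff hm z hz).inner_const e).sub
    (((tilt_integrable p v hv π hπpos hπdiff.continuous hm z).inner_const e).const_mul _)

theorem A6 (p : ℕ) (v : ℝ) (hv : 0 < v) (π : EuclideanSpace ℝ (Fin p) → ℝ)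
    (hπpos : ∀ μ, 0 < π μ) (hπdiff : Differentiable ℝ π)
    (hm : ∀ z, Integrable (fun μ => gauss p v μ z * π μ)) (z : EuclideanSpace ℝ (Fin p))
    (hz : Integrable (fun μ => Phi p v π z μ)) : ∫ μ, (gauss p v μ z * π μ) • (μ - z) = v • margGrad p v π z := by
  refine ext_inner_right ℝ fun e => ?_
  have h := integral_mul_fderiv_eq_neg_fderiv_mul_of_integrable (μ := volume)
      (f := fun _ : EuclideanSpace ℝ (Fin p) => (1:ℝ)) (g := fun μ => gauss p v μ z * π μ) (v := e)
      (by simp) (by simpa using A5 p v hv π hπpos hπdiff hm z hz e) (by simpa using hm z)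
      (fun x _ => by fun_prop) 
      (fun x _ => (A4 p v hv π hπpos hπdiff z x e).1.differentiableAt)
  simp only [(A4 p v hv π hπpos hπdiff z _ e).2] at h
  have ht := tilt_integrable p v hv π hπpos hπdiff.continuous hm z
  have h2 := A2 p v hv π hπpos hπdiff hm z hz
  have i1 := h2.inner_const (𝕜 := ℝ) e
  have i2 := (ht.inner_const (𝕜 := ℝ) e).const_mul v⁻¹
  simp only [one_mul, fderiv_fun_const, Pi.zero_apply, ContinuousLinearMap.zero_apply,
    zero_mul, integral_zero, neg_zero] at h
  rw [integral_sub i1 i2, integral_const_mul] at h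
  have q1 : ∫ μ, inner ℝ (gauss p v μ z • gradient π μ) e = inner ℝ (margGrad p v π z) e := by
    simp only [real_inner_comm e]
    rw [integral_inner h2]; rfl
  have q2 : ∫ μ, inner ℝ ((gauss p v μ z * π μ) • (μ - z)) e
      = inner ℝ (∫ μ, (gauss p v μ z * π μ) • (μ - z)) e := by
    simp only [real_inner_comm e]
    rw [integral_inner ht]
  rw [q1, q2] at h
  rw [inner_smul_left]
  simp only [conj_trivial]
  field_simp at h
  linarith

theorem mu_int (p : ℕ) (v : ℝ) (hv : 0 < v) (π : EuclideanSpace ℝ (Fin p) → ℝ)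
    (hπpos : ∀ μ, 0 < π μ) (hπdiff : Differentiable ℝ π)
    (hm : ∀ z, Integrable (fun μ => gauss p v μ z * π μ)) (z : EuclideanSpace ℝ (Fin p)) : Integrable (fun μ => (gauss p v μ z * π μ) • μ) := by
  refine ((tilt_integrable p v hv π hπpos hπdiff.continuous hm z).add
    ((hm z).smul_const z)).congr (Eventually.of_forall fun μ => ?_)
  simp [← smul_add]

theorem A7 (p : ℕ) (v : ℝ) (hv : 0 < v) (π : EuclideanSpace ℝ (Fin p) → ℝ)
    (hπpos : ∀ μ, 0 < π μ) (hπdiff : Differentiable ℝ π)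
    (hm : ∀ z, Integrable (fun μ => gauss p v μ z * π μ)) (z : EuclideanSpace ℝ (Fin p))
    (hz : Integrable (fun μ => Phi p v π z μ)) : postMean p v π z = z + v • cc p v π z := by
  have h := A6 p v hv π hπpos hπdiff hm z hz
  simp only [smul_sub] at h
  rw [integral_sub (mu_int p v hv π hπpos hπdiff hm z) ((hm z).smul_const z),
    integral_smul_const] at h
  have hM := (marg_pos p v hv π hπpos hm z).ne'
  change _ - marg p v π z • z = _ at h
  rw [sub_eq_iff_eq_add] at h
  unfold postMean cc
  rw [h, smul_add, smul_smul _ _ z, inv_mul_cancel₀ hM, one_smul, add_comm, smul_comm]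

theorem jG (n : ℕ) (μ : EuclideanSpace ℝ (Fin p)) :
    jj p n μ ^ 2 * (Gc p n μ / jj p n μ) = jj p n μ * Gc p n μ := by
  by_cases h : jj p n μ = 0
  · simp [h]
  · field_simp

theorem jj_meas (n : ℕ) : Measurable (jj p n) := (jj_cont p n).measurable

theorem Xn_meas (n : ℕ) : Measurable (Xn p n) := by
  unfold Xn
  have : Measurable (Gc p n) := by
    unfold Gc
    refine Measurable.ite (measurableSet_lt measurable_const measurable_norm) ?_ measurable_const
    fun_prop
  exact (this.div (jj_meas p n)).smul measurable_id

theorem Gn_nonneg (n : ℕ) (μ : EuclideanSpace ℝ (Fin p)) : 0 ≤ Gn p n μ := by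
  unfold Gn; positivity

theorem Gn_eq (n : ℕ) (hn : 2 ≤ n) (μ : EuclideanSpace ℝ (Fin p)) :
    Gn p n μ = if 1 < ‖μ‖ ∧ ‖μ‖ < n then 4 / (‖μ‖ ^ 2 * Real.log n ^ 2) else 0 := by
  have hl := logn_pos n hn
  unfold Gn Xn Gc
  by_cases h1 : 1 < ‖μ‖
  · by_cases h2 : ‖μ‖ < n
    · have hj : jj p n μ ≠ 0 := by
        rw [← jj_eq p n hn, if_neg (not_le.2 h1), if_pos h2.le]
        have := Real.log_lt_log (by linarith) h2
        rw [sub_ne_zero]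
        rw [ne_comm, Ne, div_eq_one_iff_eq hl.ne']
        exact this.ne
      simp only [h1, h2, and_self, if_true]
      rw [norm_smul, mul_pow, Real.norm_eq_abs, sq_abs]
      have : ‖μ‖ ≠ 0 := by linarith
      field_simp
      norm_num
    · simp [h2, jj_zero p n hn μ (not_lt.1 h2)]
  · simp [h1]

theorem Gn_bd (n : ℕ) (hn : 2 ≤ n) (μ : EuclideanSpace ℝ (Fin p)) :
    Gn p n μ ≤ 4 / Real.log n ^ 2 := by
  have hl := logn_pos n hn
  rw [Gn_eq p n hn]
  split_ifs with h
  · apply div_le_div_of_nonneg_left (by norm_num) (by positivity)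
    have : 1 ≤ ‖μ‖ ^ 2 := one_le_pow₀ h.1.le
    nlinarith [sq_nonneg (Real.log n)]
  · positivity

theorem Gn_tendsto (μ : EuclideanSpace ℝ (Fin p)) :
    Tendsto (fun n => Gn p n μ) atTop (nhds 0) := by
  have h : Tendsto (fun n : ℕ => Real.log n) atTop atTop :=
    Real.tendsto_log_atTop.comp tendsto_natCast_atTop_atTop
  have h2 : Tendsto (fun n : ℕ => 4 / Real.log n ^ 2) atTop (nhds 0) :=
    tendsto_const_nhds.div_atTop ((tendsto_pow_atTop (by norm_num)).comp h)
  refine squeeze_zero' (Eventually.of_forall fun n => Gn_nonneg p n μ) ?_ h2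
  filter_upwards [eventually_ge_atTop 2] with n hn using Gn_bd p n hn μ

theorem Gn_meas (n : ℕ) : Measurable (Gn p n) := by
  unfold Gn
  exact ((jj_meas p n).pow_const 2).mul ((Xn_meas p n).norm.pow_const 2)

theorem GnF_int (p : ℕ) (v : ℝ) (π : EuclideanSpace ℝ (Fin p) → ℝ)
    (hm : ∀ z, Integrable (fun μ => gauss p v μ z * π μ)) (z : EuclideanSpace ℝ (Fin p)) (n : ℕ) (hn : 2 ≤ n) : Integrable (fun μ => Gn p n μ * (gauss p v μ z * π μ)) := by
  refine (hm z).bdd_mul (c := 4 / Real.log n ^ 2) (Gn_meas p n).aestronglyMeasurable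
    (Eventually.of_forall fun μ => ?_)
  rw [Real.norm_of_nonneg (Gn_nonneg p n μ)]
  exact Gn_bd p n hn μ

theorem wX_int2 (p : ℕ) (v : ℝ) (π : EuclideanSpace ℝ (Fin p) → ℝ)
    (hm : ∀ z, Integrable (fun μ => gauss p v μ z * π μ)) (z : EuclideanSpace ℝ (Fin p)) (n : ℕ) (hn : 2 ≤ n) :
    Integrable (fun μ => (jj p n μ ^ 2 * (gauss p v μ z * π μ)) * ‖Xn p n μ‖ ^ 2) := by
  refine (GnF_int p v π hm z n hn).congr (Eventually.of_forall fun μ => ?_)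
  simp only [Gn]; ring

theorem wX_int (p : ℕ) (v : ℝ) (hv : 0 < v) (π : EuclideanSpace ℝ (Fin p) → ℝ)
    (hπpos : ∀ μ, 0 < π μ) (hm : ∀ z, Integrable (fun μ => gauss p v μ z * π μ))
    (z : EuclideanSpace ℝ (Fin p)) (n : ℕ) (hn : 2 ≤ n) :
    Integrable (fun μ => (jj p n μ ^ 2 * (gauss p v μ z * π μ)) • Xn p n μ) :=
  first_moment _ _ (fun μ => mul_nonneg (sq_nonneg _)
      (mul_pos (gauss_pos' p v hv μ z) (hπpos μ)).le) (w_int p v π hm z n)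
    (Xn_meas p n).aestronglyMeasurable (wX_int2 p v π hm z n hn)

theorem bdd_smul_int (n : ℕ) (Y : EuclideanSpace ℝ (Fin p) → EuclideanSpace ℝ (Fin p))
    (hY : Integrable Y) : Integrable (fun μ => jj p n μ ^ 2 • Y μ) := by
  refine hY.norm.mono' (((jj_cont p n).pow 2).aestronglyMeasurable.smul hY.aestronglyMeasurable)
    (Eventually.of_forall fun μ => ?_)
  rw [norm_smul, Real.norm_of_nonneg (by positivity)]
  exact mul_le_of_le_one_left (norm_nonneg _) (pow_le_one₀ (jj_nonneg p n μ) (jj_le_one p n μ))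

theorem A8 (p : ℕ) (v : ℝ) (hv : 0 < v) (π : EuclideanSpace ℝ (Fin p) → ℝ)
    (hπpos : ∀ μ, 0 < π μ) (hπdiff : Differentiable ℝ π)
    (hm : ∀ z, Integrable (fun μ => gauss p v μ z * π μ)) (z : EuclideanSpace ℝ (Fin p))
    (hz : Integrable (fun μ => Phi p v π z μ)) (n : ℕ) (hn : 2 ≤ n) :
    ∫ μ, (jj p n μ ^ 2 * (gauss p v μ z * π μ)) • (μ - postMean p v π z)
      = v • (An p v π n z + ∫ μ, (jj p n μ ^ 2 * (gauss p v μ z * π μ)) • Xn p n μ) := by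
  have hA1 := A1 p v hv π hπpos hπdiff hm z hz
  have hA1n : Integrable (fun μ => (jj p n μ ^ 2 * (gauss p v μ z * π μ)) •
      (scr p π μ - cc p v π z)) := by
    simpa only [smul_smul] using bdd_smul_int p n _ hA1
  have ht := tilt_integrable p v hv π hπpos hπdiff.continuous hm z
  have hB : Integrable (fun μ => (jj p n μ ^ 2 * (gauss p v μ z * π μ)) •
      (μ - postMean p v π z)) := by
    have := (bdd_smul_int p n _ ht).sub ((w_int p v π hm z n).smul_const (v • cc p v π z))
    refine this.congr (Eventually.of_forall fun μ => ?_)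
    simp only [Pi.sub_apply, smul_smul (jj p n μ ^ 2)]
    rw [A7 p v hv π hπpos hπdiff hm z hz, ← smul_sub, sub_sub]
  have hX := wX_int p v hv π hπpos hm z n hn
  refine ext_inner_left ℝ fun e => ?_
  have ibp := ibp_j p n hn (fun μ => gauss p v μ z * π μ)
    (fun μ => (A4 p v hv π hπpos hπdiff z μ e).1.differentiableAt) (hm z) e
    (A5 p v hv π hπpos hπdiff hm z hz e)
  have hF' : Integrable (fun μ => jj p n μ ^ 2 *
      fderiv ℝ (fun μ => gauss p v μ z * π μ) μ e) := by
    refine (A5 p v hv π hπpos hπdiff hm z hz e).bdd_mul (c := 1)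
      ((jj_cont p n).pow 2).aestronglyMeasurable (Eventually.of_forall fun μ => ?_)
    rw [Real.norm_of_nonneg (by positivity)]
    exact pow_le_one₀ (jj_nonneg p n μ) (jj_le_one p n μ)
  have e1 : ∀ μ, (jj p n μ * Gc p n μ * inner ℝ μ e) * (gauss p v μ z * π μ) =
      inner ℝ e ((jj p n μ ^ 2 * (gauss p v μ z * π μ)) • Xn p n μ) := by
    intro μ
    unfold Xn
    rw [smul_smul, inner_smul_right, ← jG, real_inner_comm]; ring
  simp only [e1] at ibp
  have e2 : ∀ μ, inner ℝ e ((jj p n μ ^ 2 * (gauss p v μ z * π μ)) • (μ - postMean p v π z))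
      = v * inner ℝ e ((jj p n μ ^ 2 * (gauss p v μ z * π μ)) • (scr p π μ - cc p v π z))
        - v * (jj p n μ ^ 2 * fderiv ℝ (fun μ => gauss p v μ z * π μ) μ e) := by
    intro μ
    rw [(A4 p v hv π hπpos hπdiff z μ e).2, A7 p v hv π hπpos hπdiff hm z hz]
    have := (hπpos μ).ne'
    simp only [scr, inner_smul_right, inner_sub_right, inner_add_right, inner_smul_left,
      inner_sub_left, conj_trivial, real_inner_comm e]
    field_simp
    ring
  rw [← integral_inner hB]
  simp only [e2]
  rw [integral_sub ((hA1n.const_inner e).const_mul v) (hF'.const_mul v), integral_const_mul,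
    integral_const_mul, ibp, integral_inner hX, integral_inner hA1n, inner_smul_right,
    inner_add_right]
  unfold An
  ring

theorem marg_n (n : ℕ) : marg p v (fun μ => jj p n μ ^ 2 * π μ) z = Mn p v π n z := by
  unfold marg Mn
  congr 1; ext μ; ring

theorem postMean_n (n : ℕ) : postMean p v (fun μ => jj p n μ ^ 2 * π μ) z =
    (Mn p v π n z)⁻¹ • ∫ μ, (jj p n μ ^ 2 * (gauss p v μ z * π μ)) • μ := by
  unfold postMean
  rw [marg_n]
  congr 2; ext1 μ; congr 1; ring

noncomputable def Tn (p : ℕ) (v : ℝ) (π : EuclideanSpace ℝ (Fin p) → ℝ) (n : ℕ)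
    (z : EuclideanSpace ℝ (Fin p)) : ℝ :=
  Mn p v π n z * ‖(Mn p v π n z)⁻¹ • An p v π n z‖ ^ 2

theorem A9 (p : ℕ) (v : ℝ) (hv : 0 < v) (π : EuclideanSpace ℝ (Fin p) → ℝ)
    (hπpos : ∀ μ, 0 < π μ) (hπdiff : Differentiable ℝ π)
    (hm : ∀ z, Integrable (fun μ => gauss p v μ z * π μ)) (z : EuclideanSpace ℝ (Fin p))
    (hz : Integrable (fun μ => Phi p v π z μ)) (n : ℕ) (hn : 2 ≤ n) :
    Mn p v π n z * ‖postMean p v π z - postMean p v (fun μ => jj p n μ ^ 2 * π μ) z‖ ^ 2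
      ≤ 2 * v ^ 2 * (Tn p v π n z + ∫ μ, Gn p n μ * (gauss p v μ z * π μ)) := by
  have hM := Mn_pos p v hv π hπpos hm z n
  have h8 := A8 p v hv π hπpos hπdiff hm z hz n hn
  have hmu : Integrable (fun μ => (jj p n μ ^ 2 * (gauss p v μ z * π μ)) • μ) := by
    simpa only [smul_smul] using bdd_smul_int p n _ (mu_int p v hv π hπpos hπdiff hm z)
  simp only [smul_sub] at h8
  rw [integral_sub hmu ((w_int p v π hm z n).smul_const _), integral_smul_const] at h8
  change _ - Mn p v π n z • _ = _ at h8
  set B := ∫ μ, (jj p n μ ^ 2 * (gauss p v μ z * π μ)) • Xn p n μ with hB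
  set M := Mn p v π n z with hMdef
  have hd : postMean p v (fun μ => jj p n μ ^ 2 * π μ) z - postMean p v π z
      = v • (M⁻¹ • An p v π n z + M⁻¹ • B) := by
    rw [postMean_n, ← smul_add, smul_comm v, ← h8, smul_sub, smul_smul, ← hMdef,
      inv_mul_cancel₀ hM.ne', one_smul]
  have hJ := jensen_sq (fun μ => jj p n μ ^ 2 * (gauss p v μ z * π μ)) (Xn p n)
    (fun μ => mul_nonneg (sq_nonneg _) (mul_pos (gauss_pos' p v hv μ z) (hπpos μ)).le)
    (w_int p v π hm z n) (wX_int p v hv π hπpos hm z n hn) (wX_int2 p v π hm z n hn) hM.ne'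
  have hQ : ∫ μ, (jj p n μ ^ 2 * (gauss p v μ z * π μ)) * ‖Xn p n μ‖ ^ 2 =
      ∫ μ, Gn p n μ * (gauss p v μ z * π μ) := by
    congr 1; ext μ; simp only [Gn]; ring
  rw [hQ] at hJ
  change M * ‖M⁻¹ • B‖ ^ 2 ≤ _ at hJ
  rw [norm_sub_rev, hd, norm_smul, mul_pow, Real.norm_eq_abs, sq_abs]
  unfold Tn
  rw [← hMdef]
  set x := M⁻¹ • An p v π n z
  set y := M⁻¹ • B
  have hxy : ‖x + y‖ ^ 2 ≤ 2 * (‖x‖ ^ 2 + ‖y‖ ^ 2) := by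
    have := norm_add_le x y
    nlinarith [sq_nonneg (‖x‖ - ‖y‖), norm_nonneg (x + y), norm_nonneg x, norm_nonneg y]
  calc M * (v ^ 2 * ‖x + y‖ ^ 2) ≤ M * (v ^ 2 * (2 * (‖x‖ ^ 2 + ‖y‖ ^ 2))) := by gcongr
    _ = 2 * v ^ 2 * (M * ‖x‖ ^ 2 + M * ‖y‖ ^ 2) := by ring
    _ ≤ _ := by gcongr

theorem Tn_bd (p : ℕ) (v : ℝ) (hv : 0 < v) (π : EuclideanSpace ℝ (Fin p) → ℝ)
    (hπpos : ∀ μ, 0 < π μ) (hπdiff : Differentiable ℝ π)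
    (hm : ∀ z, Integrable (fun μ => gauss p v μ z * π μ)) (z : EuclideanSpace ℝ (Fin p))
    (hz : Integrable (fun μ => Phi p v π z μ)) (n : ℕ) : Tn p v π n z ≤ ∫ μ, Phi p v π z μ := by
  have hM := Mn_pos p v hv π hπpos hm z n
  have hA1n : Integrable (fun μ => (jj p n μ ^ 2 * (gauss p v μ z * π μ)) •
      (scr p π μ - cc p v π z)) := by
    simpa only [smul_smul] using bdd_smul_int p n _ (A1 p v hv π hπpos hπdiff hm z hz)
  have hle : ∀ μ, jj p n μ ^ 2 ≤ 1 := fun μ => pow_le_one₀ (jj_nonneg p n μ) (jj_le_one p n μ)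
  have e : ∀ μ, (jj p n μ ^ 2 * (gauss p v μ z * π μ)) * ‖scr p π μ - cc p v π z‖ ^ 2
      = jj p n μ ^ 2 * Phi p v π z μ := by
    intro μ
    unfold Phi
    rw [norm_sub_rev]; ring
  have hi : Integrable (fun μ => jj p n μ ^ 2 * Phi p v π z μ) := by
    refine hz.bdd_mul (c := 1)
      ((jj_cont p n).pow 2).aestronglyMeasurable (Eventually.of_forall fun μ => ?_)
    rw [Real.norm_of_nonneg (by positivity)]
    exact hle μ
  have hJ := jensen_sq (fun μ => jj p n μ ^ 2 * (gauss p v μ z * π μ))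
    (fun μ => scr p π μ - cc p v π z)
    (fun μ => mul_nonneg (sq_nonneg _) (mul_pos (gauss_pos' p v hv μ z) (hπpos μ)).le)
    (w_int p v π hm z n) hA1n (by simpa only [e] using hi) hM.ne'
  simp only [e] at hJ
  refine le_trans hJ (integral_mono hi hz fun μ => ?_)
  have : 0 ≤ Phi p v π z μ := by
    unfold Phi
    have := hπpos μ
    have := gauss_pos' p v hv μ z
    positivity
  exact mul_le_of_le_one_left this (hle μ)

theorem Tn_tendsto (p : ℕ) (v : ℝ) (hv : 0 < v) (π : EuclideanSpace ℝ (Fin p) → ℝ)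
    (hπpos : ∀ μ, 0 < π μ) (hπdiff : Differentiable ℝ π)
    (hm : ∀ z, Integrable (fun μ => gauss p v μ z * π μ)) (z : EuclideanSpace ℝ (Fin p))
    (hz : Integrable (fun μ => Phi p v π z μ)) : Tendsto (fun n => Tn p v π n z) atTop (nhds 0) := by
  have hA1 := A1 p v hv π hπpos hπdiff hm z hz
  have hle : ∀ n μ, ‖jj p n μ ^ 2‖ ≤ 1 := fun n μ => by
    rw [Real.norm_of_nonneg (by positivity)]
    exact pow_le_one₀ (jj_nonneg p n μ) (jj_le_one p n μ)
  have h1 : Tendsto (fun n => An p v π n z) atTop (nhds 0) := by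
    rw [← A3 p v hv π hπpos hπdiff hm z hz]
    unfold An
    simp only [mul_smul _ (_ * _)]
    refine tendsto_integral_of_dominated_convergence
      (fun μ => ‖(gauss p v μ z * π μ) • (scr p π μ - cc p v π z)‖)
      (fun n => ((jj_cont p n).pow 2).aestronglyMeasurable.smul hA1.aestronglyMeasurable) hA1.norm
      (fun n => Eventually.of_forall fun μ => ?_) (Eventually.of_forall fun μ => ?_)
    · rw [norm_smul]
      exact mul_le_of_le_one_left (norm_nonneg _) (hle n μ)
    · have := ((jj_tendsto p μ).pow 2).smul_const
        ((gauss p v μ z * π μ) • (scr p π μ - cc p v π z))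
      simpa using this
  have h2 : Tendsto (fun n => Mn p v π n z) atTop (nhds (marg p v π z)) := by
    unfold Mn marg
    refine tendsto_integral_of_dominated_convergence
      (fun μ => ‖(gauss p v μ z * π μ)‖)
      (fun n => (w_int p v π hm z n).aestronglyMeasurable) (hm z).norm
      (fun n => Eventually.of_forall fun μ => ?_) (Eventually.of_forall fun μ => ?_)
    · rw [norm_mul]
      exact mul_le_of_le_one_left (norm_nonneg _) (hle n μ)
    · have := ((jj_tendsto p μ).pow 2).mul_const (gauss p v μ z * π μ)
      simpa using this
  have hM := (marg_pos p v hv π hπpos hm z).ne'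
  have h3 := h2.mul ((((h2.inv₀ hM).smul h1).norm).pow 2)
  simpa [Tn] using h3

end good


section glob

variable (p : ℕ) (v : ℝ) (hv : 0 < v) (π : EuclideanSpace ℝ (Fin p) → ℝ)
    (hπpos : ∀ μ, 0 < π μ) (hπdiff : Differentiable ℝ π)
    (hm : ∀ z, Integrable (fun μ => gauss p v μ z * π μ))
    (hflat : (∫⁻ z, ∫⁻ μ, ENNReal.ofReal (π μ *
        ‖(marg p v π z)⁻¹ • margGrad p v π z - (π μ)⁻¹ • gradient π μ‖ ^ 2 *
        gauss p v μ z)) < ⊤)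

theorem Phi_nonneg (p : ℕ) (v : ℝ) (hv : 0 < v) (π : EuclideanSpace ℝ (Fin p) → ℝ)
    (hπpos : ∀ μ, 0 < π μ) (z μ : EuclideanSpace ℝ (Fin p)) : 0 ≤ Phi p v π z μ := by
  unfold Phi
  have := hπpos μ
  have := gauss_pos' p v hv μ z
  positivity

theorem Phi_int (p : ℕ) (v : ℝ) (hv : 0 < v) (π : EuclideanSpace ℝ (Fin p) → ℝ)
    (hπpos : ∀ μ, 0 < π μ) (hπdiff : Differentiable ℝ π)
    (hflat : (∫⁻ z, ∫⁻ μ, ENNReal.ofReal (π μ *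
        ‖(marg p v π z)⁻¹ • margGrad p v π z - (π μ)⁻¹ • gradient π μ‖ ^ 2 *
        gauss p v μ z)) < ⊤) : Integrable (fun q : EuclideanSpace ℝ (Fin p) × EuclideanSpace ℝ (Fin p) =>
    Phi p v π q.1 q.2) (volume.prod volume) := by
  have hmeas : Measurable (fun q : EuclideanSpace ℝ (Fin p) × EuclideanSpace ℝ (Fin p) =>
      Phi p v π q.1 q.2) := by
    unfold Phi
    have h1 := (cc_meas p v π hπdiff.continuous.measurable).measurable
    have h2 := scr_meas p π hπdiff.continuous
    have h3 := hπdiff.continuous.measurable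
    exact ((h3.comp measurable_snd).mul
      (((h1.comp measurable_fst).sub (h2.comp measurable_snd)).norm.pow_const 2)).mul
      (gauss_contswap p v).measurable
  refine ⟨hmeas.aestronglyMeasurable, ?_⟩
  rw [hasFiniteIntegral_iff_ofReal (Eventually.of_forall fun q => Phi_nonneg p v hv π hπpos _ _)]
  rw [lintegral_prod _ hmeas.ennreal_ofReal.aemeasurable]
  exact hflat

theorem good_ae (p : ℕ) (v : ℝ) (hv : 0 < v) (π : EuclideanSpace ℝ (Fin p) → ℝ)
    (hπpos : ∀ μ, 0 < π μ) (hπdiff : Differentiable ℝ π)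
    (hflat : (∫⁻ z, ∫⁻ μ, ENNReal.ofReal (π μ *
        ‖(marg p v π z)⁻¹ • margGrad p v π z - (π μ)⁻¹ • gradient π μ‖ ^ 2 *
        gauss p v μ z)) < ⊤) : ∀ᵐ z : EuclideanSpace ℝ (Fin p), Integrable (fun μ => Phi p v π z μ) :=
  (Phi_int p v hv π hπpos hπdiff hflat).prod_right_ae

/-- any function with support in a ball, dominated by `π` is integrable -/
theorem pin_cs (hπc : Continuous π) (n : ℕ) (hn : 2 ≤ n) :
    HasCompactSupport (fun μ => jj p n μ ^ 2 * π μ) := by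
  refine HasCompactSupport.intro (isCompact_closedBall (0 : EuclideanSpace ℝ (Fin p)) n) ?_
  intro μ hμ
  have : (n : ℝ) ≤ ‖μ‖ := by
    simp only [Metric.mem_closedBall, dist_zero_right, not_le] at hμ
    exact hμ.le
  simp [jj_zero p n hn μ this]

theorem pin_cont (hπc : Continuous π) (n : ℕ) : Continuous (fun μ => jj p n μ ^ 2 * π μ) := by
  have := jj_cont p n
  fun_prop

theorem pin_int (hπc : Continuous π) (n : ℕ) (hn : 2 ≤ n) :
    Integrable (fun μ => jj p n μ ^ 2 * π μ) :=
  (pin_cont p π hπc n).integrable_of_hasCompactSupport (pin_cs p π hπc n hn)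

theorem pin_scr_int (p : ℕ) (v : ℝ) (hv : 0 < v) (π : EuclideanSpace ℝ (Fin p) → ℝ)
    (hπpos : ∀ μ, 0 < π μ) (hπdiff : Differentiable ℝ π)
    (hm : ∀ z, Integrable (fun μ => gauss p v μ z * π μ))
    (hflat : (∫⁻ z, ∫⁻ μ, ENNReal.ofReal (π μ *
        ‖(marg p v π z)⁻¹ • margGrad p v π z - (π μ)⁻¹ • gradient π μ‖ ^ 2 *
        gauss p v μ z)) < ⊤) (n : ℕ) (hn : 2 ≤ n) :
    Integrable (fun μ => (jj p n μ ^ 2 * π μ) * ‖scr p π μ‖ ^ 2) := by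
  obtain ⟨z, hz⟩ := (good_ae p v hv π hπpos hπdiff hflat).exists
  have hc := (hm z).mul_const (‖cc p v π z‖ ^ 2)
  set δ : ℝ := (2 * Real.pi * v) ^ (-(p : ℝ) / 2) * Real.exp (-(‖z‖ + n) ^ 2 / (2 * v)) with hδ
  have hδ0 : 0 < δ := by positivity
  refine (((hz.add hc).const_mul 2).const_mul δ⁻¹).mono' ?_ (Eventually.of_forall fun μ => ?_)
  · exact (pin_cont p π hπdiff.continuous n).aestronglyMeasurable.mul
      ((scr_meas p π hπdiff.continuous).norm.pow_const 2).aestronglyMeasurable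
  · have hp := hπpos μ
    have hg := gauss_pos' p v hv μ z
    rw [Real.norm_of_nonneg (by positivity)]
    simp only [Pi.add_apply, Phi]
    by_cases h : ‖μ‖ ≤ n
    · have hδg : δ ≤ gauss p v μ z := by
        unfold gauss
        rw [hδ]
        gcongr
        exact (norm_sub_le _ _).trans (by gcongr)
      rw [le_inv_mul_iff₀ hδ0]
      have hle : jj p n μ ^ 2 ≤ 1 := pow_le_one₀ (jj_nonneg p n μ) (jj_le_one p n μ)
      have hs : ‖scr p π μ‖ ^ 2 ≤ 2 * (‖cc p v π z - scr p π μ‖ ^ 2 + ‖cc p v π z‖ ^ 2) := by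
        have h1 : ‖scr p π μ‖ ≤ ‖cc p v π z - scr p π μ‖ + ‖cc p v π z‖ := by
          have := norm_sub_le (cc p v π z - scr p π μ) (cc p v π z)
          rw [sub_sub_cancel_left, norm_neg] at this
          exact this
        nlinarith [sq_nonneg (‖cc p v π z - scr p π μ‖ - ‖cc p v π z‖), norm_nonneg (scr p π μ)]
      calc δ * (jj p n μ ^ 2 * π μ * ‖scr p π μ‖ ^ 2)
          ≤ gauss p v μ z * (1 * π μ *
            (2 * (‖cc p v π z - scr p π μ‖ ^ 2 + ‖cc p v π z‖ ^ 2))) := by gcongr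
        _ = _ := by ring
    · rw [jj_zero p n hn μ (not_le.1 h).le]
      simp
      positivity

theorem risk_int_a (p : ℕ) (v : ℝ) (hv : 0 < v) (π : EuclideanSpace ℝ (Fin p) → ℝ)
    (hπpos : ∀ μ, 0 < π μ) (hπdiff : Differentiable ℝ π)
    (hm : ∀ z, Integrable (fun μ => gauss p v μ z * π μ))
    (hflat : (∫⁻ z, ∫⁻ μ, ENNReal.ofReal (π μ *
        ‖(marg p v π z)⁻¹ • margGrad p v π z - (π μ)⁻¹ • gradient π μ‖ ^ 2 *
        gauss p v μ z)) < ⊤) (n : ℕ) (hn : 2 ≤ n) :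
    Integrable (fun q : EuclideanSpace ℝ (Fin p) × EuclideanSpace ℝ (Fin p) =>
      (jj p n q.1 ^ 2 * π q.1) * (gauss p v q.1 q.2 * ‖postMean p v π q.2 - q.1‖ ^ 2))
      (volume.prod volume) := by
  have hπc := hπdiff.continuous
  have i1 := kernel_prod_integrable p (fun μ => jj p n μ ^ 2 * π μ)
    (fun μ z => gauss p v μ z * ‖z - μ‖ ^ 2) (gsec p v) 
    (by have := gauss_cont p v; fun_prop)
    (fun μ z => mul_nonneg (gauss_pos' p v hv μ z).le (by positivity))
    (gauss_sq_integrable_z p v hv) (gauss_sec p v) (pin_int p π hπc n hn)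
  have i2 := (Phi_int p v hv π hπpos hπdiff hflat).swap
  have i3 := kernel_prod_integrable p (fun μ => (jj p n μ ^ 2 * π μ) * ‖scr p π μ‖ ^ 2)
    (fun μ z => gauss p v μ z) (gmass p v) (gauss_cont p v)
    (fun μ z => (gauss_pos' p v hv μ z).le)
    (gauss_integrable_z p v hv) (gauss_mass p v) 
    (pin_scr_int p v hv π hπpos hπdiff hm hflat n hn)
  have hae : ∀ᵐ q : EuclideanSpace ℝ (Fin p) × EuclideanSpace ℝ (Fin p) ∂(volume.prod volume),
      Integrable (fun μ => Phi p v π q.2 μ) :=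
    Measure.quasiMeasurePreserving_snd.ae (good_ae p v hv π hπpos hπdiff hflat)
  refine (((i1.add (i2.const_mul (v ^ 2))).add (i3.const_mul (v ^ 2))).const_mul 3).mono' ?_ ?_
  · have h1 := (postMean_meas p v π hπc.measurable).measurable
    exact (((pin_cont p π hπc n).measurable.comp measurable_fst).mul
      ((gauss_cont p v).measurable.mul
      (((h1.comp measurable_snd).sub measurable_fst).norm.pow_const 2))).aestronglyMeasurable
  · filter_upwards [hae] with q hq
    obtain ⟨μ, z⟩ := q
    simp only at hq ⊢
    have hp := hπpos μ
    have hg := gauss_pos' p v hv μ z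
    rw [Real.norm_of_nonneg (by positivity), A7 p v hv π hπpos hπdiff hm z hq]
    simp only [Pi.add_apply, Phi, Prod.swap, Function.comp]
    have hle : jj p n μ ^ 2 ≤ 1 := pow_le_one₀ (jj_nonneg p n μ) (jj_le_one p n μ)
    set c := cc p v π z
    set s := scr p π μ
    have hn1 : ‖z + v • c - μ‖ ≤ ‖z - μ‖ + v * ‖c - s‖ + v * ‖s‖ := by
      have e : z + v • c - μ = (z - μ) + v • (c - s) + v • s := by
        rw [smul_sub]; abel
      rw [e]
      refine (norm_add₃_le).trans ?_
      rw [norm_smul, norm_smul, Real.norm_of_nonneg hv.le]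
    have hn2 : ‖z + v • c - μ‖ ^ 2 ≤ 3 * (‖z - μ‖ ^ 2 + v ^ 2 * ‖c - s‖ ^ 2 + v ^ 2 * ‖s‖ ^ 2) := by
      have := pow_le_pow_left₀ (norm_nonneg _) hn1 2
      nlinarith [sq_nonneg (‖z - μ‖ - v * ‖c - s‖), sq_nonneg (‖z - μ‖ - v * ‖s‖),
        sq_nonneg (v * ‖c - s‖ - v * ‖s‖)]
    calc jj p n μ ^ 2 * π μ * (gauss p v μ z * ‖z + v • c - μ‖ ^ 2)
        ≤ jj p n μ ^ 2 * π μ * (gauss p v μ z * 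
          (3 * (‖z - μ‖ ^ 2 + v ^ 2 * ‖c - s‖ ^ 2 + v ^ 2 * ‖s‖ ^ 2))) := by gcongr
      _ = 3 * (jj p n μ ^ 2 * π μ * (gauss p v μ z * ‖z - μ‖ ^ 2) +
          v ^ 2 * (jj p n μ ^ 2 * (π μ * ‖c - s‖ ^ 2 * gauss p v μ z)) +
          v ^ 2 * (jj p n μ ^ 2 * π μ * ‖s‖ ^ 2 * gauss p v μ z)) := by ring
      _ ≤ _ := by
        have h5 : jj p n μ ^ 2 * (π μ * ‖c - s‖ ^ 2 * gauss p v μ z)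
            ≤ π μ * ‖c - s‖ ^ 2 * gauss p v μ z :=
          mul_le_of_le_one_left (by positivity) hle
        have h6 := mul_le_mul_of_nonneg_left h5 (sq_nonneg v)
        linarith

theorem postMean_n_bd (p : ℕ) (v : ℝ) (hv : 0 < v) (π : EuclideanSpace ℝ (Fin p) → ℝ)
    (hπpos : ∀ μ, 0 < π μ) (hπdiff : Differentiable ℝ π)
    (hm : ∀ z, Integrable (fun μ => gauss p v μ z * π μ)) (n : ℕ) (hn : 2 ≤ n) (z : EuclideanSpace ℝ (Fin p)) :
    ‖postMean p v (fun μ => jj p n μ ^ 2 * π μ) z‖ ≤ n := by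
  have hM := Mn_pos p v hv π hπpos hm z n
  rw [postMean_n, norm_smul, norm_inv, Real.norm_of_nonneg hM.le, inv_mul_le_iff₀ hM]
  unfold Mn
  rw [← integral_mul_const]
  refine norm_integral_le_of_norm_le ((w_int p v π hm z n).mul_const _)
    (Eventually.of_forall fun μ => ?_)
  have hp := hπpos μ
  have hg := gauss_pos' p v hv μ z
  rw [norm_smul, Real.norm_of_nonneg (by positivity)]
  by_cases h : ‖μ‖ ≤ n
  · gcongr
  · rw [jj_zero p n hn μ (not_le.1 h).le]
    simp

theorem risk_int_b (p : ℕ) (v : ℝ) (hv : 0 < v) (π : EuclideanSpace ℝ (Fin p) → ℝ)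
    (hπpos : ∀ μ, 0 < π μ) (hπdiff : Differentiable ℝ π)
    (hm : ∀ z, Integrable (fun μ => gauss p v μ z * π μ)) (n : ℕ) (hn : 2 ≤ n) :
    Integrable (fun q : EuclideanSpace ℝ (Fin p) × EuclideanSpace ℝ (Fin p) =>
      (jj p n q.1 ^ 2 * π q.1) * (gauss p v q.1 q.2 *
        ‖postMean p v (fun μ => jj p n μ ^ 2 * π μ) q.2 - q.1‖ ^ 2))
      (volume.prod volume) := by
  have hπc := hπdiff.continuous
  have i1 := kernel_prod_integrable p (fun μ => jj p n μ ^ 2 * π μ)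
    (fun μ z => gauss p v μ z) (gmass p v) (gauss_cont p v)
    (fun μ z => (gauss_pos' p v hv μ z).le)
    (gauss_integrable_z p v hv) (gauss_mass p v) (pin_int p π hπc n hn)
  refine (i1.mul_const ((n + n : ℝ) ^ 2)).mono' ?_ (Eventually.of_forall fun q => ?_)
  · have h1 := (postMean_meas p v _ (pin_cont p π hπc n).measurable).measurable
    exact (((pin_cont p π hπc n).measurable.comp measurable_fst).mul
      ((gauss_cont p v).measurable.mul
      (((h1.comp measurable_snd).sub measurable_fst).norm.pow_const 2))).aestronglyMeasurable
  · obtain ⟨μ, z⟩ := q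
    have hp := hπpos μ
    have hg := gauss_pos' p v hv μ z
    simp only
    rw [Real.norm_of_nonneg (by positivity), ← mul_assoc]
    by_cases h : ‖μ‖ ≤ n
    · have := (norm_sub_le (postMean p v (fun μ => jj p n μ ^ 2 * π μ) z) μ).trans
        (add_le_add (postMean_n_bd p v hv π hπpos hπdiff hm n hn z) h)
      gcongr
    · rw [jj_zero p n hn μ (not_le.1 h).le]
      simp

theorem delta_eq (p : ℕ) (v : ℝ) (hv : 0 < v) (π : EuclideanSpace ℝ (Fin p) → ℝ)
    (hπpos : ∀ μ, 0 < π μ) (hπdiff : Differentiable ℝ π)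
    (hm : ∀ z, Integrable (fun μ => gauss p v μ z * π μ))
    (hflat : (∫⁻ z, ∫⁻ μ, ENNReal.ofReal (π μ *
        ‖(marg p v π z)⁻¹ • margGrad p v π z - (π μ)⁻¹ • gradient π μ‖ ^ 2 *
        gauss p v μ z)) < ⊤) (n : ℕ) (hn : 2 ≤ n) :
    bQ p v (fun μ => jj p n μ ^ 2 * π μ) (postMean p v π)
      - bQ p v (fun μ => jj p n μ ^ 2 * π μ) (postMean p v (fun μ => jj p n μ ^ 2 * π μ))
    = ∫ z, Mn p v π n z *
      ‖postMean p v π z - postMean p v (fun μ => jj p n μ ^ 2 * π μ) z‖ ^ 2 := by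
  have hπc := hπdiff.continuous
  have ia := risk_int_a p v hv π hπpos hπdiff hm hflat n hn
  have ib := risk_int_b p v hv π hπpos hπdiff hm n hn
  unfold bQ qRisk
  simp only [← integral_const_mul]
  have sa := integral_integral_swap (f := fun μ z => (jj p n μ ^ 2 * π μ) *
    (gauss p v μ z * ‖postMean p v π z - μ‖ ^ 2)) ia
  have sb := integral_integral_swap (f := fun μ z => (jj p n μ ^ 2 * π μ) *
    (gauss p v μ z * ‖postMean p v (fun μ => jj p n μ ^ 2 * π μ) z - μ‖ ^ 2)) ib
  rw [sa, sb, ← integral_sub ia.integral_prod_right ib.integral_prod_right]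
  congr 1
  ext z
  have hj := jj_cont p n
  have hg := gauss_cont1 p v z
  have e : ∀ a μ : EuclideanSpace ℝ (Fin p), jj p n μ ^ 2 * π μ * (gauss p v μ z * ‖a - μ‖ ^ 2)
      = (jj p n μ ^ 2 * (gauss p v μ z * π μ)) * ‖a - μ‖ ^ 2 := fun a μ => by ring
  simp only [e]
  have h0 : HasCompactSupport (fun μ => jj p n μ ^ 2 * (gauss p v μ z * π μ)) := by
    have := (pin_cs p π hπc n hn).mul_right (f' := fun μ => gauss p v μ z)
    convert! this using 1
    ext μ; simp only [Pi.mul_apply]; ring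
  have h1 : Integrable (fun μ => (jj p n μ ^ 2 * (gauss p v μ z * π μ)) • μ) :=
    Continuous.integrable_of_hasCompactSupport (by fun_prop) h0.smul_right
  have h2 : Integrable (fun μ => (jj p n μ ^ 2 * (gauss p v μ z * π μ)) * ‖μ‖ ^ 2) :=
    Continuous.integrable_of_hasCompactSupport (by fun_prop) h0.mul_right
  have := bias_var (fun μ => jj p n μ ^ 2 * (gauss p v μ z * π μ)) (fun μ => μ)
    (w_int p v π hm z n) h1 h2 (Mn_pos p v hv π hπpos hm z n).ne' (postMean p v π z)
  simp only [postMean_n]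
  exact this

theorem Mn_meas (hπc : Continuous π) (n : ℕ) : StronglyMeasurable (Mn p v π n) := by
  have := marg_meas p v _ (pin_cont p π hπc n).measurable
  convert! this using 1
  ext z; rw [marg_n]

theorem Tn_meas (hπc : Continuous π) (n : ℕ) : StronglyMeasurable (Tn p v π n) := by
  have hA : StronglyMeasurable (An p v π n) := by
    unfold An
    have h1 := (cc_meas p v π hπc.measurable).measurable
    have h2 := scr_meas p π hπc
    have : StronglyMeasurable (fun q : EuclideanSpace ℝ (Fin p) × EuclideanSpace ℝ (Fin p) =>
        (jj p n q.2 ^ 2 * (gauss p v q.2 q.1 * π q.2)) • (scr p π q.2 - cc p v π q.1)) := by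
      refine Measurable.stronglyMeasurable ?_
      exact ((((jj_meas p n).comp measurable_snd).pow_const 2).mul
        ((gauss_contswap p v).measurable.mul (hπc.measurable.comp measurable_snd))).smul
        ((h2.comp measurable_snd).sub (h1.comp measurable_fst))
    exact this.integral_prod_right' (ν := volume)
  have hM := Mn_meas p v π hπc n
  unfold Tn
  exact hM.mul ((hM.inv₀.smul hA).norm.pow 2)

theorem Tn_int_tendsto (p : ℕ) (v : ℝ) (hv : 0 < v) (π : EuclideanSpace ℝ (Fin p) → ℝ)
    (hπpos : ∀ μ, 0 < π μ) (hπdiff : Differentiable ℝ π)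
    (hm : ∀ z, Integrable (fun μ => gauss p v μ z * π μ))
    (hflat : (∫⁻ z, ∫⁻ μ, ENNReal.ofReal (π μ *
        ‖(marg p v π z)⁻¹ • margGrad p v π z - (π μ)⁻¹ • gradient π μ‖ ^ 2 *
        gauss p v μ z)) < ⊤) :
    (∀ n, Integrable (Tn p v π n)) ∧ Tendsto (fun n => ∫ z, Tn p v π n z) atTop (nhds 0) := by
  have hK := (Phi_int p v hv π hπpos hπdiff hflat).integral_prod_left
  have hg := good_ae p v hv π hπpos hπdiff hflat
  have hb : ∀ n, ∀ᵐ z, ‖Tn p v π n z‖ ≤ ∫ μ, Phi p v π z μ := by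
    intro n
    filter_upwards [hg] with z hz
    rw [Real.norm_of_nonneg]
    · exact Tn_bd p v hv π hπpos hπdiff hm z hz n
    · have := Mn_pos p v hv π hπpos hm z n
      unfold Tn; positivity
  refine ⟨fun n => hK.mono' (Tn_meas p v π hπdiff.continuous n).aestronglyMeasurable (hb n), ?_⟩
  have := tendsto_integral_of_dominated_convergence (fun z => ∫ μ, Phi p v π z μ)
    (F := fun n z => Tn p v π n z) (f := fun _ => (0:ℝ)) (μ := volume)
    (fun n => (Tn_meas p v π hπdiff.continuous n).aestronglyMeasurable) hK hb
    (by
      filter_upwards [hg] with z hz using Tn_tendsto p v hv π hπpos hπdiff hm z hz)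
  simpa using this

theorem Gpi_tendsto (p : ℕ) (π : EuclideanSpace ℝ (Fin p) → ℝ) (hπpos : ∀ μ, 0 < π μ)
    (hπdiff : Differentiable ℝ π)
    (hgrowth : IntegrableOn (fun μ => π μ / (‖μ‖ ^ 2 * Real.log (max ‖μ‖ 2) ^ 2))
      {μ : EuclideanSpace ℝ (Fin p) | 1 < ‖μ‖}) :
    (∀ n, 2 ≤ n → Integrable (fun μ => Gn p n μ * π μ)) ∧
    Tendsto (fun n => ∫ μ, Gn p n μ * π μ) atTop (nhds 0) := by
  have hS : MeasurableSet {μ : EuclideanSpace ℝ (Fin p) | 1 < ‖μ‖} :=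
    measurableSet_lt measurable_const measurable_norm
  have hI := ((integrable_indicator_iff hS).2 hgrowth).const_mul 4
  have hmeas : ∀ n, AEStronglyMeasurable (fun μ => Gn p n μ * π μ) volume := fun n =>
    ((Gn_meas p n).mul hπdiff.continuous.measurable).aestronglyMeasurable
  have hb : ∀ n, 2 ≤ n → ∀ μ, ‖Gn p n μ * π μ‖ ≤ 4 * Set.indicator {μ | 1 < ‖μ‖} 
      (fun μ => π μ / (‖μ‖ ^ 2 * Real.log (max ‖μ‖ 2) ^ 2)) μ := by
    intro n hn μ
    have hp := hπpos μ
    rw [Real.norm_of_nonneg (mul_nonneg (Gn_nonneg p n μ) hp.le), Gn_eq p n hn]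
    by_cases h1 : 1 < ‖μ‖
    · rw [Set.indicator_of_mem (by exact h1)]
      by_cases h2 : ‖μ‖ < n
      · simp only [h1, h2, and_self, if_true]
        have hn2 : (2 : ℝ) ≤ n := by exact_mod_cast hn
        have l1 : Real.log (max ‖μ‖ 2) ≤ Real.log n :=
          Real.log_le_log (by positivity) (max_le h2.le hn2)
        have l0 : 0 < Real.log (max ‖μ‖ 2) := Real.log_pos (lt_max_of_lt_left h1)
        calc 4 / (‖μ‖ ^ 2 * Real.log n ^ 2) * π μ
            ≤ 4 / (‖μ‖ ^ 2 * Real.log (max ‖μ‖ 2) ^ 2) * π μ := by gcongr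
          _ = _ := by ring
      · simp only [h2, and_false, if_false, zero_mul]
        positivity
    · simp [h1]
  refine ⟨fun n hn => hI.mono' (hmeas n) (Eventually.of_forall (hb n hn)), ?_⟩
  have := tendsto_integral_filter_of_dominated_convergence (l := atTop) (μ := volume)
    (F := fun n μ => Gn p n μ * π μ) (f := fun _ => (0:ℝ)) _
    (Eventually.of_forall hmeas)
    (by filter_upwards [eventually_ge_atTop 2] with n hn using Eventually.of_forall (hb n hn)) hI
    (Eventually.of_forall fun μ => by simpa using (Gn_tendsto p μ).mul_const (π μ))
  simpa using this

theorem Q_int (p : ℕ) (v : ℝ) (hv : 0 < v) (π : EuclideanSpace ℝ (Fin p) → ℝ)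
    (hπpos : ∀ μ, 0 < π μ) (hπdiff : Differentiable ℝ π)
    (hgrowth : IntegrableOn (fun μ => π μ / (‖μ‖ ^ 2 * Real.log (max ‖μ‖ 2) ^ 2))
      {μ : EuclideanSpace ℝ (Fin p) | 1 < ‖μ‖}) (n : ℕ) (hn : 2 ≤ n) :
    Integrable (fun z => ∫ μ, Gn p n μ * (gauss p v μ z * π μ)) ∧
    ∫ z, ∫ μ, Gn p n μ * (gauss p v μ z * π μ) = (∫ μ, Gn p n μ * π μ) * gmass p v := by
  have i1 := kernel_prod_integrable p (fun μ => Gn p n μ * π μ)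
    (fun μ z => gauss p v μ z) (gmass p v) (gauss_cont p v)
    (fun μ z => (gauss_pos' p v hv μ z).le)
    (gauss_integrable_z p v hv) (gauss_mass p v)
    ((Gpi_tendsto p π hπpos hπdiff hgrowth).1 n hn)
  have e : ∀ z μ : EuclideanSpace ℝ (Fin p), Gn p n μ * (gauss p v μ z * π μ) =
      Gn p n μ * π μ * gauss p v μ z := fun z μ => by ring
  simp only [e]
  refine ⟨i1.integral_prod_right, ?_⟩
  rw [← integral_integral_swap i1]
  simp only [integral_const_mul, gauss_mass, integral_mul_const]

end glob

/-- Under the growth and asymptotic flatness conditions at a given sampling variance `v`, the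
Brown–Hwang truncation sequence `πₙ = jₙ² π` satisfies
`Δₙ = B_Q^v(πₙ, μ̂_π) - B_Q^v(πₙ, μ̂_{πₙ}) → 0`. -/
theorem brown_hwang_truncation_average_quadratic_risk_difference_tendsto_zero
    (p : ℕ) (v : ℝ) (hv : 0 < v)
    (π : EuclideanSpace ℝ (Fin p) → ℝ)
    (hπpos : ∀ μ, 0 < π μ) (hπdiff : Differentiable ℝ π)
    (hm : ∀ z, Integrable (fun μ => gauss p v μ z * π μ))
    (hgrowth : IntegrableOn (fun μ => π μ / (‖μ‖ ^ 2 * Real.log (max ‖μ‖ 2) ^ 2))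
      {μ : EuclideanSpace ℝ (Fin p) | 1 < ‖μ‖})
    (hflat : (∫⁻ z, ∫⁻ μ, ENNReal.ofReal (π μ *
        ‖(marg p v π z)⁻¹ • margGrad p v π z - (π μ)⁻¹ • gradient π μ‖ ^ 2 *
        gauss p v μ z)) < ⊤)
    (jn : ℕ → EuclideanSpace ℝ (Fin p) → ℝ)
    (hjn : jn = fun (n : ℕ) (μ : EuclideanSpace ℝ (Fin p)) =>
      if ‖μ‖ ≤ 1 then 1
      else if ‖μ‖ ≤ (n : ℝ) then 1 - Real.log ‖μ‖ / Real.log (n : ℝ)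
      else 0)
    (πn : ℕ → EuclideanSpace ℝ (Fin p) → ℝ)
    (hπn : πn = fun n μ => (jn n μ) ^ 2 * π μ) :
    Tendsto
      (fun n => bQ p v (πn n) (postMean p v π) - bQ p v (πn n) (postMean p v (πn n)))
      atTop (nhds 0) := by
  subst hπn hjn
  have hpn : ∀ n : ℕ, 2 ≤ n → (fun μ : EuclideanSpace ℝ (Fin p) =>
      (if ‖μ‖ ≤ 1 then 1 else if ‖μ‖ ≤ (n : ℝ) then 1 - Real.log ‖μ‖ / Real.log (n : ℝ)
        else 0 : ℝ) ^ 2 * π μ) = fun μ => jj p n μ ^ 2 * π μ := by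
    intro n hn
    funext μ
    rw [← jj_eq p n hn μ]
  obtain ⟨hT1, hT2⟩ := Tn_int_tendsto p v hv π hπpos hπdiff hm hflat
  obtain ⟨-, hG2⟩ := Gpi_tendsto p π hπpos hπdiff hgrowth
  have hlim : Tendsto (fun n : ℕ => 2 * v ^ 2 * ((∫ z, Tn p v π n z)
      + (∫ μ, Gn p n μ * π μ) * gmass p v)) atTop (nhds 0) := by
    have := (hT2.add (hG2.mul_const (gmass p v))).const_mul (2 * v ^ 2)
    simpa using this
  refine squeeze_zero' ?_ ?_ hlim
  · filter_upwards [eventually_ge_atTop 2] with n hn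
    rw [hpn n hn, delta_eq p v hv π hπpos hπdiff hm hflat n hn]
    exact integral_nonneg fun z =>
      mul_nonneg (Mn_pos p v hv π hπpos hm z n).le (sq_nonneg _)
  · filter_upwards [eventually_ge_atTop 2] with n hn
    rw [hpn n hn, delta_eq p v hv π hπpos hπdiff hm hflat n hn]
    obtain ⟨hQ1, hQ2⟩ := Q_int p v hv π hπpos hπdiff hgrowth n hn
    rw [← hQ2, ← integral_add (hT1 n) hQ1, ← integral_const_mul]
    refine integral_mono_of_nonneg (Eventually.of_forall fun z =>
      mul_nonneg (Mn_pos p v hv π hπpos hm z n).le (sq_nonneg _))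
      (((hT1 n).add hQ1).const_mul _) ?_
    filter_upwards [good_ae p v hv π hπpos hπdiff hflat] with z hz
    exact A9 p v hv π hπpos hπdiff hm z hz n hn
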